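/- arXiv:2601.14789 — 3 statements merged into one kernel-verified Lean document; each statement's English description precedes it below -/
import Mathlib

section
/- (Lévy's lemma.) Let D ≥ 1, let σ be the unitarily invariant (uniform) probability measure on the unit sphere of ℂ^D, and let f be a real-valued function on the unit sphere that is Lipschitz with constant η > 0 with respect to the ambient Euclidean distance. Then for every δ > 0, σ{ψ : |f(ψ) − ∫ f dσ| ≥ δ} ≤ 2 · exp(−2·D·δ² / (9·π³·(ln 2)·η²)). -/
open MeasureTheory
open ProbabilityTheory

lemma pi_gaussian_ac (n : ℕ) :
    Measure.pi (fun _ : Fin n => gaussianReal 0 1) ≪ (volume : Measure (Fin n → ℝ)) := by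
  induction n with
  | zero =>
    rw [volume_pi]
    rw [Measure.pi_of_empty, Measure.pi_of_empty]
  | succ n ih =>
    have h1 := measurePreserving_piFinSuccAbove (fun _ : Fin (n+1) => gaussianReal 0 1) 0
    have h2 := measurePreserving_piFinSuccAbove (fun _ : Fin (n+1) => (volume : Measure ℝ)) 0
    have h3 := Measure.AbsolutelyContinuous.prod
      (gaussianReal_absolutelyContinuous 0 (v := 1) one_ne_zero) ih
    have h4 := h3.map (MeasurableEquiv.piFinSuccAbove (fun _ : Fin (n+1) => ℝ) 0).symm.measurable
    rw [h1.symm.map_eq.symm, volume_pi, h2.symm.map_eq.symm]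
    exact h4

section
variable {E : Type*} [NormedAddCommGroup E] [InnerProductSpace ℝ E] [FiniteDimensional ℝ E]
  [MeasurableSpace E] [BorelSpace E]

lemma ae_diff_gaussian (F : E → ℝ) (C : NNReal) (hF : LipschitzWith C F) :
    ∀ᵐ x ∂(stdGaussian E), DifferentiableAt ℝ F x := by
  let b := stdOrthonormalBasis ℝ E
  let φ : (Fin (Module.finrank ℝ E) → ℝ) ≃L[ℝ] E := b.toBasis.equivFun.symm.toContinuousLinearEquiv
  have hφ : (fun x : Fin (Module.finrank ℝ E) → ℝ ↦ ∑ i, x i • stdOrthonormalBasis ℝ E i) = φ := by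
    ext x
    have h := b.toBasis.equivFun_symm_apply x
    simp only [OrthonormalBasis.coe_toBasis] at h
    exact h.symm
  rw [stdGaussian, hφ, ae_map_iff φ.continuous.aemeasurable (measurableSet_of_differentiableAt ℝ F)]
  have hG : LipschitzWith (C * ‖(φ : (Fin (Module.finrank ℝ E) → ℝ) →L[ℝ] E)‖₊) (F ∘ φ) :=
    hF.comp (φ : (Fin (Module.finrank ℝ E) → ℝ) →L[ℝ] E).lipschitz
  have := hG.ae_differentiableAt (μ := volume)
  filter_upwards [(pi_gaussian_ac _).ae_le this] with x hx
  exact φ.comp_right_differentiableAt_iff.mp hx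

lemma integrable_exp_norm_gaussian (c : ℝ) :
    Integrable (fun x : E => Real.exp (c * ‖x‖)) (stdGaussian E) := by
  obtain ⟨C, hC, hi⟩ := IsGaussian.exists_integrable_exp_sq (stdGaussian E)
  refine (hi.const_mul (Real.exp (c^2/(4*C)))).mono' (by fun_prop) (ae_of_all _ fun x => ?_)
  rw [Real.norm_eq_abs, Real.abs_exp, ← Real.exp_add]
  gcongr
  have : c^2/(4*C) + C*‖x‖^2 - c*‖x‖ = (c - 2*C*‖x‖)^2/(4*C) := by field_simp; ring
  have : 0 ≤ (c - 2*C*‖x‖)^2/(4*C) := by positivity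
  linarith

lemma integral_exp_dual_gaussian (L : StrongDual ℝ E) :
    ∫ y, Real.exp (L y) ∂(stdGaussian E) = Real.exp (‖L‖^2/2) := by
  have h := IsGaussian.map_eq_gaussianReal (μ := stdGaussian E) L
  have h2 := mgf_gaussianReal (p := stdGaussian E) (X := L) h 1
  simp only [mgf, one_mul, integral_strongDual_stdGaussian, variance_dual_stdGaussian] at h2
  rw [h2]
  simp

/-- one step of the rotation path -/
noncomputable def stepF (F : E → ℝ) (ε : ℝ) (z : E × E) : ℝ :=
  F (Real.cos ε • z.1 + Real.sin ε • z.2) - F z.1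

lemma stepF_bound (F : E → ℝ) (C : NNReal) (hF : LipschitzWith C F) (ε : ℝ) (hε : 0 ≤ ε)
    (z : E × E) : |stepF F ε z| ≤ C * ε * (‖z.1‖ + ‖z.2‖) := by
  have h := hF.dist_le_mul (Real.cos ε • z.1 + Real.sin ε • z.2) z.1
  rw [Real.dist_eq, dist_eq_norm] at h
  refine h.trans ?_
  rw [mul_assoc]
  gcongr
  have e : Real.cos ε • z.1 + Real.sin ε • z.2 - z.1 = (Real.cos ε - 1) • z.1 + Real.sin ε • z.2 := by
    module
  rw [e]
  refine (norm_add_le _ _).trans ?_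
  rw [norm_smul, norm_smul, mul_add]
  gcongr
  · rw [Real.norm_eq_abs, abs_sub_comm, abs_of_nonneg (by linarith [Real.cos_le_one ε])]
    by_cases h2 : ε ≤ 2
    · have := Real.one_sub_sq_div_two_le_cos (x := ε)
      nlinarith
    · linarith [Real.neg_one_le_cos ε]
  · rw [Real.norm_eq_abs]
    exact (Real.abs_sin_le_abs).trans_eq (abs_of_nonneg hε)

lemma integrable_exp_two (c : ℝ) :
    Integrable (fun z : E × E => Real.exp (c * (‖z.1‖ + ‖z.2‖)))
      ((stdGaussian E).prod (stdGaussian E)) := by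
  have := (integrable_exp_norm_gaussian (E := E) c).mul_prod (integrable_exp_norm_gaussian (E := E) c)
  refine this.congr (ae_of_all _ fun z => ?_)
  simp only [← Real.exp_add, mul_add]

lemma integrable_exp_step (F : E → ℝ) (C : NNReal) (hF : LipschitzWith C F) (ε : ℝ) (hε : 0 ≤ ε)
    (N : ℝ) (hN : 0 ≤ N) :
    Integrable (fun z : E × E => Real.exp (N * stepF F ε z))
      ((stdGaussian E).prod (stdGaussian E)) := by
  have hc := hF.continuous
  refine (integrable_exp_two (E := E) (N * (C * ε))).mono'
    (by unfold stepF; fun_prop) (ae_of_all _ fun z => ?_)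
  rw [Real.norm_eq_abs, Real.abs_exp]
  refine Real.exp_le_exp.mpr ?_
  rw [mul_assoc]
  gcongr
  exact (le_abs_self _).trans (stepF_bound F C hF ε hε z)

lemma integrable_exp_diff (F : E → ℝ) (C : NNReal) (hF : LipschitzWith C F) :
    Integrable (fun z : E × E => Real.exp (F z.2 - F z.1))
      ((stdGaussian E).prod (stdGaussian E)) := by
  have := integrable_exp_step F C hF (Real.pi/2) (by positivity) 1 zero_le_one
  simpa [stepF] using this

lemma mp_discrete (F : E → ℝ) (C : NNReal) (hF : LipschitzWith C F) (n : ℕ) :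
    ∫ z, Real.exp (F z.2 - F z.1) ∂((stdGaussian E).prod (stdGaussian E)) ≤
    ∫ z, Real.exp ((n + 1 : ℝ) * stepF F (Real.pi / 2 / (n + 1)) z)
      ∂((stdGaussian E).prod (stdGaussian E)) := by
  set ε := Real.pi / 2 / (n + 1 : ℝ) with hε
  have hε0 : 0 ≤ ε := by positivity
  set μ := (stdGaussian E).prod (stdGaussian E) with hμ
  have hN : (0:ℝ) < n + 1 := by positivity
  have hc := hF.continuous
  have hInteg := integrable_exp_step F C hF ε hε0 (n+1) hN.le
  have hmp : ∀ θ, MeasurePreserving (ContinuousLinearMap.rotation (E := E) θ) μ μ := fun θ =>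
    ⟨(ContinuousLinearMap.rotation θ).continuous.measurable,
      IsGaussian.map_rotation_eq_self (by simp) θ⟩
  have hstep : ∀ (k : ℕ) (z : E × E), stepF F ε (ContinuousLinearMap.rotation (k * ε) z) =
      F (ContinuousLinearMap.rotation ((k + 1 : ℕ) * ε) z).1 -
        F (ContinuousLinearMap.rotation (k * ε) z).1 := by
    intro k z
    simp only [stepF, ContinuousLinearMap.rotation_apply]
    congr 2
    push_cast
    rw [add_mul, one_mul, Real.cos_add, Real.sin_add]
    module
  have hptw : ∀ z : E × E, Real.exp (F z.2 - F z.1) ≤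
      ∑ k ∈ Finset.range (n+1), (1 / (n+1 : ℝ)) *
        Real.exp ((n+1 : ℝ) * stepF F ε (ContinuousLinearMap.rotation (k * ε) z)) := by
    intro z
    have h1 : ∑ k ∈ Finset.range (n+1), stepF F ε (ContinuousLinearMap.rotation (k * ε) z)
        = F z.2 - F z.1 := by
      simp_rw [hstep]
      rw [Finset.sum_range_sub (fun k : ℕ => F (ContinuousLinearMap.rotation (k * ε) z).1)]
      have : ((n + 1 : ℕ) : ℝ) * ε = Real.pi / 2 := by
        rw [hε]; push_cast; field_simp
      rw [this]
      simp [ContinuousLinearMap.rotation_apply]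
    have h2 := convexOn_exp.map_sum_le (t := Finset.range (n+1)) (w := fun _ => 1 / (n+1 : ℝ))
      (p := fun k : ℕ => (n+1 : ℝ) * stepF F ε (ContinuousLinearMap.rotation (k * ε) z))
      (fun _ _ => by positivity) (by simp; field_simp) (fun _ _ => Set.mem_univ _)
    simp only [smul_eq_mul] at h2
    refine le_trans (le_of_eq ?_) h2
    congr 1
    rw [← h1]
    refine Finset.sum_congr rfl fun k _ => ?_
    field_simp
  have hIntegK : ∀ k : ℕ, Integrable (fun z => Real.exp ((n+1 : ℝ) *
      stepF F ε (ContinuousLinearMap.rotation (k * ε) z))) μ := fun k =>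
    (hmp (k * ε)).integrable_comp_of_integrable hInteg
  refine (integral_mono (integrable_exp_diff F C hF)
    (integrable_finsetSum _ fun k _ => (hIntegK k).const_mul _) hptw).trans (le_of_eq ?_)
  rw [integral_finsetSum _ fun k _ => (hIntegK k).const_mul _]
  have : ∀ k : ℕ, ∫ z, (1 / (n+1 : ℝ)) * Real.exp ((n+1 : ℝ) *
      stepF F ε (ContinuousLinearMap.rotation (k * ε) z)) ∂μ =
      (1 / (n+1 : ℝ)) * ∫ z, Real.exp ((n+1 : ℝ) * stepF F ε z) ∂μ := by
    intro k
    rw [integral_const_mul]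
    congr 1
    have h := integral_map (μ := μ) (hmp (k * ε)).measurable.aemeasurable
      (f := fun z => Real.exp ((n+1 : ℝ) * stepF F ε z))
      (by rw [(hmp (k * ε)).map_eq]; exact hInteg.aestronglyMeasurable)
    rw [(hmp (k * ε)).map_eq] at h
    exact h.symm
  simp_rw [this]
  simp
  field_simp

lemma stepF_tendsto (F : E → ℝ) (x y : E) (hx : DifferentiableAt ℝ F x) :
    Filter.Tendsto (fun n : ℕ => (n + 1 : ℝ) * stepF F (Real.pi / 2 / (n + 1)) (x, y))
      Filter.atTop (nhds ((Real.pi / 2) * fderiv ℝ F x y)) := by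
  have h1 : HasDerivAt (fun t : ℝ => Real.cos t • x + Real.sin t • y) y 0 := by
    have := ((Real.hasDerivAt_cos 0).smul_const x).add ((Real.hasDerivAt_sin 0).smul_const y)
    simp at this
    exact this
  have h2 : HasFDerivAt F (fderiv ℝ F x) (Real.cos 0 • x + Real.sin 0 • y) := by
    simpa using hx.hasFDerivAt
  have h3 := h2.comp_hasDerivAt 0 h1
  rw [hasDerivAt_iff_tendsto_slope] at h3
  have h4 : Filter.Tendsto (fun n : ℕ => Real.pi / 2 / (n + 1 : ℝ)) Filter.atTop
      (nhdsWithin 0 {0}ᶜ) := by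
    rw [tendsto_nhdsWithin_iff]
    constructor
    · have := (tendsto_one_div_add_atTop_nhds_zero_nat (𝕜 := ℝ)).const_mul (Real.pi/2)
      simpa [div_eq_mul_inv] using this
    · refine Filter.Eventually.of_forall fun n => ?_
      have : Real.pi / 2 / (n + 1 : ℝ) ≠ 0 := by positivity
      simpa using this
  have h5 := (h3.comp h4).const_mul (Real.pi / 2)
  refine h5.congr fun n => ?_
  simp only [Function.comp, slope, stepF, vsub_eq_sub, smul_eq_mul, sub_zero]
  have := Real.pi_pos
  simp
  field_simp

theorem maurey_pisier (F : E → ℝ) (C : NNReal) (hF : LipschitzWith C F) :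
    ∫ z, Real.exp (F z.2 - F z.1) ∂((stdGaussian E).prod (stdGaussian E)) ≤
      Real.exp (Real.pi^2 * C^2 / 8) := by
  set μ := (stdGaussian E).prod (stdGaussian E) with hμ
  have hc := hF.continuous
  have hae : ∀ᵐ z ∂μ, DifferentiableAt ℝ F z.1 :=
    Measure.quasiMeasurePreserving_fst.ae (ae_diff_gaussian F C hF)
  have hlim := tendsto_integral_of_dominated_convergence (μ := μ)
    (F := fun n : ℕ => fun z => Real.exp ((n + 1 : ℝ) * stepF F (Real.pi / 2 / (n + 1)) z))
    (f := fun z => Real.exp ((Real.pi / 2) * fderiv ℝ F z.1 z.2))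
    (fun z => Real.exp ((C * (Real.pi/2)) * (‖z.1‖ + ‖z.2‖)))
    (fun n => by unfold stepF; fun_prop)
    (integrable_exp_two _)
    (fun n => ae_of_all _ fun z => by
      rw [Real.norm_eq_abs, Real.abs_exp]
      refine Real.exp_le_exp.mpr ?_
      have h := (le_abs_self _).trans
        (stepF_bound F C hF (Real.pi / 2 / (n + 1)) (by positivity) z)
      calc _ ≤ (n+1 : ℝ) * (C * (Real.pi / 2 / (n + 1)) * (‖z.1‖ + ‖z.2‖)) := by gcongr
        _ = _ := by field_simp)
    (by
      filter_upwards [hae] with z hz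
      exact (Real.continuous_exp.tendsto _).comp (stepF_tendsto F z.1 z.2 hz))
  refine (ge_of_tendsto' hlim (mp_discrete F C hF)).trans ?_
  have hInteg : Integrable (fun z : E × E => Real.exp ((Real.pi / 2) * fderiv ℝ F z.1 z.2)) μ := by
    refine (integrable_exp_two (E := E) (C * (Real.pi/2))).mono' ?_ (ae_of_all _ fun z => ?_)
    · have : Measurable (fun z : E × E => fderiv ℝ F z.1 z.2) := by
        have h1 : Measurable (fun z : E × E => fderiv ℝ F z.1) :=
          (measurable_fderiv ℝ F).comp measurable_fst
        exact (isBoundedBilinearMap_apply (𝕜 := ℝ) (E := E) (F := ℝ)).continuous.measurable.comp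
          (h1.prodMk measurable_snd)
      exact (by fun_prop : Measurable _).aestronglyMeasurable
    · rw [Real.norm_eq_abs, Real.abs_exp]
      refine Real.exp_le_exp.mpr ?_
      have h1 : fderiv ℝ F z.1 z.2 ≤ C * ‖z.2‖ :=
        (le_abs_self _).trans (((fderiv ℝ F z.1).le_opNorm z.2).trans
          (by gcongr; exact norm_fderiv_le_of_lipschitz ℝ hF))
      calc _ ≤ Real.pi/2 * (C * ‖z.2‖) := by gcongr
        _ ≤ Real.pi/2 * (C * (‖z.1‖ + ‖z.2‖)) := by gcongr; linarith [norm_nonneg z.1]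
        _ = _ := by ring
  rw [integral_prod _ hInteg]
  have : ∀ x, ∫ y, Real.exp ((Real.pi / 2) * fderiv ℝ F x y) ∂(stdGaussian E) ≤
      Real.exp (Real.pi^2 * C^2 / 8) := by
    intro x
    have h := integral_exp_dual_gaussian ((Real.pi / 2) • fderiv ℝ F x)
    simp only [smul_apply, smul_eq_mul] at h
    rw [h]
    refine Real.exp_le_exp.mpr ?_
    have h1 : ‖fderiv ℝ F x‖ ≤ C := norm_fderiv_le_of_lipschitz ℝ hF
    rw [norm_smul, Real.norm_eq_abs, abs_of_pos (by positivity), mul_pow]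
    have : ‖fderiv ℝ F x‖^2 ≤ (C:ℝ)^2 := by gcongr
    calc _ ≤ (Real.pi/2)^2 * (C:ℝ)^2/2 := by gcongr
      _ = _ := by ring
  calc _ ≤ ∫ x, Real.exp (Real.pi^2 * C^2 / 8) ∂(stdGaussian E) :=
        integral_mono hInteg.integral_prod_left (integrable_const _) this
    _ = _ := by simp
end

section
variable {E : Type*} [NormedAddCommGroup E] [InnerProductSpace ℝ E] [FiniteDimensional ℝ E]
  [MeasurableSpace E] [BorelSpace E]

lemma gaussian_polar (σ : Measure E) [IsProbabilityMeasure σ] (hs : ∀ᵐ u ∂σ, ‖u‖ = 1)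
    (hinv : ∀ s t : E, ‖s‖ = ‖t‖ → charFun σ s = charFun σ t) :
    ((stdGaussian E).prod σ).map (fun z => ‖z.1‖ • z.2) = stdGaussian E := by
  have : IsProbabilityMeasure (((stdGaussian E).prod σ).map (fun z => ‖z.1‖ • z.2)) :=
    Measure.isProbabilityMeasure_map (by fun_prop)
  apply Measure.ext_of_charFun
  ext t
  have hInteg : ∀ h : E × E → ℝ, Measurable h →
      Integrable (fun z : E × E => Complex.exp (h z * Complex.I)) ((stdGaussian E).prod σ) := by
    intro h hh
    refine (integrable_const (1:ℝ)).mono' (by fun_prop) (ae_of_all _ fun z => ?_)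
    rw [Complex.norm_exp_ofReal_mul_I]
  rw [charFun_apply, integral_map (by fun_prop) (by fun_prop), integral_prod _ (hInteg _ (by fun_prop))]
  have h1 : ∀ x : E, ∫ u, Complex.exp ((inner ℝ (‖x‖ • u) t : ℝ) * Complex.I) ∂σ =
      ∫ u, Complex.exp ((‖t‖ * inner ℝ x u : ℝ) * Complex.I) ∂σ := by
    intro x
    have := hinv (‖x‖ • t) (‖t‖ • x) (by simp [norm_smul, mul_comm])
    rw [charFun_apply, charFun_apply] at this
    simp only [inner_smul_right] at this
    simp only [inner_smul_left]
    convert this using 5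
    · simp
    · rw [real_inner_comm]
  simp_rw [h1]
  rw [integral_integral_swap (hInteg (fun z => ‖t‖ * inner ℝ z.1 z.2) (by fun_prop))]
  have h2 : ∀ᵐ u ∂σ, ∫ x, Complex.exp ((‖t‖ * inner ℝ x u : ℝ) * Complex.I) ∂(stdGaussian E)
      = charFun (stdGaussian E) t := by
    filter_upwards [hs] with u hu
    have := charFun_stdGaussian (‖t‖ • u)
    rw [charFun_apply] at this
    simp only [inner_smul_right] at this
    rw [this, charFun_stdGaussian, norm_smul, hu]
    simp
  rw [integral_congr_ae h2]
  simp

lemma integrable_norm_gaussian : Integrable (fun x : E => ‖x‖) (stdGaussian E) :=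
  (IsGaussian.integrable_id (μ := stdGaussian E)).norm

lemma abs_inner_mean (v : E) (hv : ‖v‖ = 1) :
    (0.39 : ℝ) ≤ ∫ x, |inner ℝ x v| ∂(stdGaussian E) := by
  have h := charFun_stdGaussian v
  rw [charFun_apply, hv] at h
  have hi : Integrable (fun x : E => Complex.exp ((inner ℝ x v : ℝ) * Complex.I)) (stdGaussian E) := by
    refine (integrable_const (1:ℝ)).mono' (by fun_prop) (ae_of_all _ fun z => ?_)
    rw [Complex.norm_exp_ofReal_mul_I]
  have hre := congrArg Complex.re h
  have h3 := integral_re hi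
  simp only [RCLike.re_to_complex] at h3
  rw [← h3] at hre
  simp only [Complex.exp_ofReal_mul_I_re] at hre
  have h4 : (Complex.exp (-((1:ℝ):ℂ)^2/2)).re = Real.exp (-1/2) := by
    rw [← Complex.exp_ofReal_re]; congr 2; push_cast; ring
  rw [h4] at hre
  have hic : Integrable (fun x : E => Real.cos (inner ℝ x v)) (stdGaussian E) := by
    refine (integrable_const (1:ℝ)).mono' (by fun_prop) (ae_of_all _ fun z => ?_)
    exact Real.abs_cos_le_one _
  have h5 : ∫ x, (1 - Real.cos (inner ℝ x v)) ∂(stdGaussian E) = 1 - Real.exp (-1/2) := by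
    rw [integral_sub (integrable_const _) hic, hre]; simp
  have h6 : ∫ x, (1 - Real.cos (inner ℝ x v)) ∂(stdGaussian E) ≤
      ∫ x, |inner ℝ x v| ∂(stdGaussian E) := by
    refine integral_mono ((integrable_const _).sub hic) ?_ fun x => ?_
    · refine (integrable_norm_gaussian (E := E)).mono' (by fun_prop) (ae_of_all _ fun x => ?_)
      have := abs_real_inner_le_norm x v
      simpa [hv] using this
    · have h0 : ∀ y : ℝ, 1 - Real.cos y ≤ |y| := by
        intro y
        by_cases h2 : |y| ≤ 2
        · have := Real.one_sub_sq_div_two_le_cos (x := y)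
          nlinarith [abs_nonneg y, sq_abs y]
        · linarith [Real.neg_one_le_cos y]
      exact h0 _
  have h7 : Real.exp (-1/2) ≤ 0.61 := by
    have e1 : Real.exp (-1/2) ^ 2 * Real.exp 1 = 1 := by
      rw [← Real.exp_nat_mul, ← Real.exp_add]; norm_num
    have e2 := Real.exp_one_gt_d9
    have e3 := Real.exp_pos (-1/2)
    by_contra hcon
    push Not at hcon
    nlinarith [mul_pos e3 e3]
  linarith

lemma norm_mean : (0.39 : ℝ)^2 * Module.finrank ℝ E ≤ (∫ x, ‖x‖ ∂(stdGaussian E))^2 := by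
  set n := Module.finrank ℝ E
  rcases Nat.eq_zero_or_pos n with h0 | hpos
  · rw [h0]; simp; positivity
  let b := stdOrthonormalBasis ℝ E
  have hi : ∀ i, Integrable (fun x : E => |inner ℝ x (b i)|) (stdGaussian E) := fun i => by
    refine (integrable_norm_gaussian (E := E)).mono' (by fun_prop) (ae_of_all _ fun x => ?_)
    have := abs_real_inner_le_norm x (b i)
    simpa using this
  have h1 : ∀ x : E, ∑ i, |inner ℝ x (b i)| ≤ √n * ‖x‖ := by
    intro x
    have h2 := sq_sum_le_card_mul_sum_sq (s := Finset.univ) (f := fun i => |inner ℝ x (b i)|)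
    simp only [sq_abs] at h2
    rw [b.sum_sq_inner_left x] at h2
    refine abs_le_of_sq_le_sq' ?_ (by positivity) |>.2
    rw [mul_pow, Real.sq_sqrt (by positivity)]
    simpa using h2
  have h3 : ∫ x, ∑ i, |inner ℝ x (b i)| ∂(stdGaussian E) ≤ ∫ x, √n * ‖x‖ ∂(stdGaussian E) :=
    integral_mono (integrable_finsetSum _ fun i _ => hi i)
      (integrable_norm_gaussian.const_mul _) h1
  rw [integral_finsetSum _ fun i _ => hi i, integral_const_mul] at h3
  have h4 : (n : ℝ) * 0.39 ≤ ∑ i, ∫ x, |inner ℝ x (b i)| ∂(stdGaussian E) := by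
    have := Finset.card_nsmul_le_sum Finset.univ (fun i => ∫ x, |inner ℝ x (b i)| ∂(stdGaussian E))
      0.39 (fun i _ => abs_inner_mean (b i) (b.orthonormal.1 i))
    simpa using this
  have hn : (0:ℝ) < n := by exact_mod_cast hpos
  have hm : 0 ≤ ∫ x, ‖x‖ ∂(stdGaussian E) := integral_nonneg fun x => norm_nonneg x
  set m := ∫ x, ‖x‖ ∂(stdGaussian E)
  have h5 := h4.trans h3
  have h6 : ((n:ℝ) * 0.39)^2 ≤ (√n * m)^2 := by gcongr
  rw [mul_pow, mul_pow, Real.sq_sqrt hn.le] at h6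
  have h7 : (n:ℝ) * (0.39^2 * n) ≤ n * m^2 := by nlinarith
  exact le_of_mul_le_mul_left h7 hn

lemma sphere_exp_bound (σ : Measure E) [IsProbabilityMeasure σ] (hs : ∀ᵐ u ∂σ, ‖u‖ = 1)
    (hinv : ∀ s t : E, ‖s‖ = ‖t‖ → charFun σ s = charFun σ t)
    (F : E → ℝ) (C : NNReal) (hF : LipschitzWith C F)
    (hhom : ∀ (r : ℝ) (u : E), 0 ≤ r → F (r • u) = r * F u) (hmean : ∫ u, F u ∂σ = 0) :
    ∫ u, Real.exp ((∫ x, ‖x‖ ∂(stdGaussian E)) * F u) ∂σ ≤ Real.exp (Real.pi^2 * C^2 / 8) := by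
  have hc := hF.continuous
  have hF0 : F 0 = 0 := by simpa using hhom 0 0 le_rfl
  have hFb : ∀ u, |F u| ≤ C * ‖u‖ := fun u => by
    have := hF.dist_le_mul u 0
    simpa [Real.dist_eq, hF0] using this
  set m := ∫ x, ‖x‖ ∂(stdGaussian E) with hm
  have hm0 : 0 ≤ m := integral_nonneg fun x => norm_nonneg x
  have hpol := gaussian_polar σ hs hinv
  have hFi : Integrable F σ := by
    refine (integrable_const (C:ℝ)).mono' (by fun_prop) ?_
    filter_upwards [hs] with u hu
    simpa [hu] using hFb u
  have hEi : ∀ c : ℝ, Integrable (fun u => Real.exp (c * F u)) σ := fun c => by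
    refine (integrable_const (Real.exp (|c| * C))).mono' (by fun_prop) ?_
    filter_upwards [hs] with u hu
    rw [Real.norm_eq_abs, Real.abs_exp]
    refine Real.exp_le_exp.mpr ((le_abs_self _).trans ?_)
    rw [abs_mul]
    gcongr
    simpa [hu] using hFb u
  have hFg : Integrable F (stdGaussian E) :=
    (integrable_norm_gaussian.const_mul (C:ℝ)).mono' (by fun_prop) (ae_of_all _ hFb)
  have hEg : ∀ c : ℝ, |c| ≤ 1 → Integrable (fun u => Real.exp (c * F u)) (stdGaussian E) := fun c hc1 => by
    refine (integrable_exp_norm_gaussian (C:ℝ)).mono' (by fun_prop) (ae_of_all _ fun u => ?_)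
    rw [Real.norm_eq_abs, Real.abs_exp]
    refine Real.exp_le_exp.mpr ((le_abs_self _).trans ?_)
    rw [abs_mul]
    have := hFb u
    nlinarith [abs_nonneg (F u), abs_nonneg c]
  -- mean zero
  have hmg : ∫ x, F x ∂(stdGaussian E) = 0 := by
    rw [← hpol, integral_map (by fun_prop) (by fun_prop)]
    have : ∀ z : E × E, F (‖z.1‖ • z.2) = ‖z.1‖ * F z.2 := fun z => hhom _ _ (norm_nonneg _)
    simp_rw [this]
    rw [integral_prod_mul (fun x : E => ‖x‖) F, hmean, mul_zero]
  have hE1 : Integrable (fun u => Real.exp (F u)) (stdGaussian E) := by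
    simpa using hEg 1 (by simp)
  have hE2 : Integrable (fun u => Real.exp (-F u)) (stdGaussian E) := by
    simpa using hEg (-1) (by simp)
  have hlow : 1 ≤ ∫ x, Real.exp (-F x) ∂(stdGaussian E) := by
    have : ∫ x, (1 - F x) ∂(stdGaussian E) ≤ ∫ x, Real.exp (-F x) ∂(stdGaussian E) :=
      integral_mono ((integrable_const _).sub hFg) hE2 fun x => Real.one_sub_le_exp_neg _
    rw [integral_sub (integrable_const _) hFg, hmg] at this
    simpa using this
  have hmp := maurey_pisier F C hF
  have hsplit : ∫ z, Real.exp (F z.2 - F z.1) ∂((stdGaussian E).prod (stdGaussian E)) =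
      (∫ x, Real.exp (-F x) ∂(stdGaussian E)) * ∫ x, Real.exp (F x) ∂(stdGaussian E) := by
    rw [← integral_prod_mul (fun x => Real.exp (-F x)) (fun x => Real.exp (F x))]
    congr 1; ext z; rw [← Real.exp_add]; congr 1; ring
  have hpos : 0 ≤ ∫ x, Real.exp (F x) ∂(stdGaussian E) := integral_nonneg fun x => (Real.exp_pos _).le
  have hup : ∫ x, Real.exp (F x) ∂(stdGaussian E) ≤ Real.exp (Real.pi^2 * C^2 / 8) := by
    rw [hsplit] at hmp
    nlinarith
  refine le_trans ?_ hup
  have hIntegT : Integrable (fun z : E × E => Real.exp (‖z.1‖ * F z.2)) ((stdGaussian E).prod σ) := by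
    have h1 : Integrable (fun x => Real.exp (F x)) (((stdGaussian E).prod σ).map (fun z => ‖z.1‖ • z.2)) := by
      rw [hpol]; exact hE1
    have h2 := h1.comp_measurable (by fun_prop)
    refine h2.congr (ae_of_all _ fun z => ?_)
    simp only [Function.comp]
    rw [hhom _ _ (norm_nonneg _)]
  have heq : ∫ x, Real.exp (F x) ∂(stdGaussian E) =
      ∫ u, ∫ x, Real.exp (‖x‖ * F u) ∂(stdGaussian E) ∂σ := by
    conv_lhs => rw [← hpol]
    rw [integral_map (by fun_prop) (by fun_prop)]
    have : ∀ z : E × E, F (‖z.1‖ • z.2) = ‖z.1‖ * F z.2 := fun z => hhom _ _ (norm_nonneg _)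
    simp_rw [this]
    rw [integral_prod_symm _ hIntegT]
  rw [heq]
  refine integral_mono (hEi m) hIntegT.integral_prod_right fun u => ?_
  have hj : ∫ x : E, Real.exp (m * F u) * (1 + (‖x‖ - m) * F u) ∂(stdGaussian E) = Real.exp (m * F u) := by
    have hi : Integrable (fun x : E => (‖x‖ - m) * F u) (stdGaussian E) :=
      (integrable_norm_gaussian.sub (integrable_const _)).mul_const _
    rw [integral_const_mul, integral_add (integrable_const _) hi, integral_mul_const,
      integral_sub integrable_norm_gaussian (integrable_const _)]
    simp [← hm]
  simp only
  rw [← hj]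
  refine integral_mono ?_ ?_ fun x => ?_
  · exact ((integrable_const _).add
      ((integrable_norm_gaussian.sub (integrable_const _)).mul_const _)).const_mul _
  · simpa [mul_comm] using integrable_exp_norm_gaussian (E := E) (F u)
  · simp only
    have e : ‖x‖ * F u = m * F u + (‖x‖ - m) * F u := by ring
    rw [e, Real.exp_add]
    gcongr
    linarith [Real.add_one_le_exp ((‖x‖ - m) * F u)]

lemma sphere_tail (σ : Measure E) [IsProbabilityMeasure σ] (hs : ∀ᵐ u ∂σ, ‖u‖ = 1)
    (hinv : ∀ s t : E, ‖s‖ = ‖t‖ → charFun σ s = charFun σ t)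
    (F : E → ℝ) (C : NNReal) (hC : 0 < C) (hF : LipschitzWith C F)
    (hhom : ∀ (r : ℝ) (u : E), 0 ≤ r → F (r • u) = r * F u) (hmean : ∫ u, F u ∂σ = 0)
    (δ : ℝ) (hδ : 0 < δ) :
    σ.real {u | δ ≤ F u} ≤
      Real.exp (-(2 * (∫ x, ‖x‖ ∂(stdGaussian E))^2 * δ^2 / (Real.pi^2 * C^2))) := by
  set m := ∫ x, ‖x‖ ∂(stdGaussian E) with hm
  have hm0 : 0 ≤ m := integral_nonneg fun x => norm_nonneg x
  have hc := hF.continuous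
  have hF0 : F 0 = 0 := by simpa using hhom 0 0 le_rfl
  have hFb : ∀ u, |F u| ≤ C * ‖u‖ := fun u => by
    have := hF.dist_le_mul u 0
    simpa [Real.dist_eq, hF0] using this
  have hCr : (0:ℝ) < C := by exact_mod_cast hC
  set l : ℝ := 4 * m * δ / (Real.pi^2 * C^2) with hl
  have hl0 : 0 ≤ l := by positivity
  have hEi : Integrable (fun u => Real.exp ((l * m) * F u)) σ := by
    refine (integrable_const (Real.exp (l * m * C))).mono' (by fun_prop) ?_
    filter_upwards [hs] with u hu
    rw [Real.norm_eq_abs, Real.abs_exp]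
    refine Real.exp_le_exp.mpr ?_
    gcongr
    simpa [hu] using (le_abs_self _).trans (hFb u)
  have h1 := measure_ge_le_exp_mul_mgf (μ := σ) (X := F) δ (mul_nonneg hl0 hm0) hEi
  have h2 := sphere_exp_bound σ hs hinv (fun u => l * F u) (Real.toNNReal l * C)
    (by
      refine LipschitzWith.of_dist_le_mul fun x y => ?_
      have := hF.dist_le_mul x y
      rw [Real.dist_eq] at this ⊢
      rw [← mul_sub, abs_mul, abs_of_nonneg hl0]
      push_cast
      rw [Real.coe_toNNReal _ hl0, mul_assoc]
      gcongr)
    (fun r u hr => by rw [hhom r u hr]; ring)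
    (by rw [integral_const_mul, hmean, mul_zero])
  push_cast at h2
  rw [Real.coe_toNNReal _ hl0] at h2
  have h3 : mgf F σ (l * m) = ∫ u, Real.exp (m * (l * F u)) ∂σ := by
    unfold mgf; congr 1; ext u; ring_nf
  rw [h3] at h1
  refine h1.trans ((mul_le_mul_of_nonneg_left h2 (Real.exp_pos _).le).trans ?_)
  rw [← Real.exp_add]
  refine Real.exp_le_exp.mpr (le_of_eq ?_)
  rw [hl]
  have := Real.pi_pos
  field_simp
  ring

lemma polar_dist (r s : ℝ) (u v : E) (hu : ‖u‖ = 1) (hv : ‖v‖ = 1) :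
    ‖r • u - s • v‖^2 = (r - s)^2 + r * s * ‖u - v‖^2 := by
  rw [norm_sub_sq_real, norm_sub_sq_real, norm_smul, norm_smul, inner_smul_left,
    inner_smul_right, hu, hv]
  simp
  ring

lemma homog_lipschitz (g : E → ℝ) (η : ℝ) (hη : 0 < η)
    (hg : ∀ u v : E, ‖u‖ = 1 → ‖v‖ = 1 → |g u - g v| ≤ η * ‖u - v‖)
    (hb : ∀ u : E, ‖u‖ = 1 → |g u| ≤ 2 * η) :
    LipschitzWith (Real.toNNReal (√5 * η)) (fun x : E => ‖x‖ * g (‖x‖⁻¹ • x)) := by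
  have h5 : (2:ℝ) ≤ √5 := by
    rw [Real.le_sqrt (by norm_num) (by norm_num)]; norm_num
  have hu : ∀ x : E, x ≠ 0 → ‖‖x‖⁻¹ • x‖ = 1 := fun x hx => by
    rw [norm_smul, norm_inv, norm_norm, inv_mul_cancel₀ (norm_ne_zero_iff.mpr hx)]
  have hz : ∀ x : E, |‖x‖ * g (‖x‖⁻¹ • x)| ≤ √5 * η * ‖x‖ := by
    intro x
    by_cases hx : x = 0
    · simp [hx]
    rw [abs_mul, abs_norm]
    have := hb _ (hu x hx)
    nlinarith [norm_nonneg x, mul_le_mul_of_nonneg_right h5 hη.le]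
  have key : ∀ x y : E, ‖y‖ ≤ ‖x‖ →
      |‖x‖ * g (‖x‖⁻¹ • x) - ‖y‖ * g (‖y‖⁻¹ • y)| ≤ √5 * η * ‖x - y‖ := by
    intro x y hxy
    by_cases hy : y = 0
    · simpa [hy] using hz x
    have hx : x ≠ 0 := by
      rintro rfl
      simp at hxy
      exact hy hxy
    have hux := hu x hx
    have huy := hu y hy
    set u := ‖x‖⁻¹ • x with hud
    set v := ‖y‖⁻¹ • y with hvd
    have ex : x = ‖x‖ • u := by rw [hud, smul_inv_smul₀ (norm_ne_zero_iff.mpr hx)]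
    have ey : y = ‖y‖ • v := by rw [hvd, smul_inv_smul₀ (norm_ne_zero_iff.mpr hy)]
    set r := ‖x‖
    set s := ‖y‖
    have hs0 : 0 ≤ s := norm_nonneg y
    have e1 : ‖x - y‖^2 = (r - s)^2 + r * s * ‖u - v‖^2 := by
      conv_lhs => rw [ex, ey]
      exact polar_dist r s u v hux huy
    have h1 := hg u v hux huy
    have h2 := hb u hux
    have e2 : r * g u - s * g v = (r - s) * g u + s * (g u - g v) := by ring
    have h3 : |r * g u - s * g v| ≤ (r - s) * (2 * η) + s * (η * ‖u - v‖) := by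
      rw [e2]
      refine (abs_add_le _ _).trans ?_
      rw [abs_mul, abs_mul, abs_of_nonneg (sub_nonneg.mpr hxy), abs_of_nonneg hs0]
      have := sub_nonneg.mpr hxy
      gcongr
    refine h3.trans (abs_le_of_sq_le_sq' ?_ (by positivity)).2
    rw [mul_pow, mul_pow, Real.sq_sqrt (by norm_num), e1]
    have h4 : s * s * ‖u - v‖^2 ≤ r * s * ‖u - v‖^2 := by gcongr
    have e3 : (r - s) * (2 * η) + s * (η * ‖u - v‖) = η * (2 * (r - s) + s * ‖u - v‖) := by ring
    rw [e3, mul_pow]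
    have h6 : (2 * (r - s) + s * ‖u - v‖)^2 ≤ 5 * ((r-s)^2 + r * s * ‖u - v‖^2) := by
      nlinarith [sq_nonneg ((r - s) - 2 * (s * ‖u - v‖))]
    nlinarith [sq_nonneg η]
  refine LipschitzWith.of_dist_le_mul fun x y => ?_
  rw [Real.dist_eq, dist_eq_norm, Real.coe_toNNReal _ (by positivity)]
  rcases le_total ‖y‖ ‖x‖ with h | h
  · exact key x y h
  · rw [abs_sub_comm, norm_sub_rev]; exact key y x h

lemma exists_unitary {n : ℕ} (s t : EuclideanSpace ℂ (Fin n)) (h : ‖s‖ = ‖t‖) :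
    ∃ U : EuclideanSpace ℂ (Fin n) ≃ₗᵢ[ℂ] EuclideanSpace ℂ (Fin n), U s = t := by
  by_cases hs : s = 0
  · subst hs
    have : t = 0 := by simpa using h.symm
    exact ⟨LinearIsometryEquiv.refl _ _, by simp [this]⟩
  have hsn : ‖s‖ ≠ 0 := norm_ne_zero_iff.mpr hs
  have key : ∀ x : EuclideanSpace ℂ (Fin n), ‖x‖ = ‖s‖ → ∃ (b : OrthonormalBasis (Fin n) ℂ
      (EuclideanSpace ℂ (Fin n))) , ∀ i : Fin n, i.val = 0 → b i = ((‖x‖:ℂ)⁻¹) • x := by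
    intro x hx
    have hx0 : ‖x‖ ≠ 0 := hx ▸ hsn
    obtain ⟨b, hb⟩ := Orthonormal.exists_orthonormalBasis_extension_of_card_eq (𝕜 := ℂ)
      (E := EuclideanSpace ℂ (Fin n)) (ι := Fin n) (by simp)
      (v := fun _ => ((‖x‖:ℂ)⁻¹) • x) (s := {i | i.val = 0}) (by
        constructor
        · intro i
          simp [norm_smul, hx0]
        · intro i j hij
          exact absurd (Subtype.ext (Fin.ext (i.2.trans j.2.symm))) hij)
    exact ⟨b, fun i hi => hb i hi⟩
  obtain ⟨b, hb⟩ := key s rfl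
  obtain ⟨c, hc⟩ := key t h.symm
  have hn : 0 < n := by
    rcases Nat.eq_zero_or_pos n with h0 | h0
    · subst h0
      exact absurd (Subsingleton.elim s 0) hs
    · exact h0
  refine ⟨b.equiv c (Equiv.refl _), ?_⟩
  have h1 : s = (‖s‖ : ℂ) • b ⟨0, hn⟩ := by
    rw [hb _ rfl, smul_inv_smul₀ (by exact_mod_cast hsn)]
  have h2 : t = (‖t‖ : ℂ) • c ⟨0, hn⟩ := by
    rw [hc _ rfl, smul_inv_smul₀ (by exact_mod_cast (h ▸ hsn))]
  calc b.equiv c (Equiv.refl _) s = b.equiv c (Equiv.refl _) ((‖s‖ : ℂ) • b ⟨0, hn⟩) := by rw [← h1]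
    _ = (‖t‖ : ℂ) • c ⟨0, hn⟩ := by
      rw [map_smul, OrthonormalBasis.equiv_apply_basis, h]; rfl
    _ = t := h2.symm
end

/-- **Lévy's lemma.** Let `σ` be the unitarily invariant probability measure
on the unit sphere of `ℂ^D` and let `f` be `η`-Lipschitz on the sphere. Then for every
`δ > 0`, `σ{ψ : |f ψ − ∫ f dσ| ≥ δ} ≤ 2 exp(−2Dδ² / (9π³ (ln 2) η²))`. -/
theorem levy_lemma (D : ℕ) (hD : 1 ≤ D)
    [MeasurableSpace (EuclideanSpace ℂ (Fin D))]
    [BorelSpace (EuclideanSpace ℂ (Fin D))]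
    (σ : Measure (EuclideanSpace ℂ (Fin D))) [IsProbabilityMeasure σ]
    (hsupp : σ (Metric.sphere (0 : EuclideanSpace ℂ (Fin D)) 1) = 1)
    (hinv : ∀ U : EuclideanSpace ℂ (Fin D) ≃ₗᵢ[ℂ] EuclideanSpace ℂ (Fin D),
      σ.map U = σ)
    (f : EuclideanSpace ℂ (Fin D) → ℝ) (η : ℝ) (hη : 0 < η)
    (hf : ∀ ψ₁ ∈ Metric.sphere (0 : EuclideanSpace ℂ (Fin D)) 1,
          ∀ ψ₂ ∈ Metric.sphere (0 : EuclideanSpace ℂ (Fin D)) 1,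
          |f ψ₁ - f ψ₂| ≤ η * ‖ψ₁ - ψ₂‖)
    (δ : ℝ) (hδ : 0 < δ) :
    (σ {ψ | δ ≤ |f ψ - ∫ φ, f φ ∂σ|}).toReal ≤
      2 * Real.exp (-(2 * D * δ ^ 2) / (9 * Real.pi ^ 3 * Real.log 2 * η ^ 2)) := by
  have hs : ∀ᵐ u ∂σ, ‖u‖ = 1 := by
    have h := (prob_compl_eq_zero_iff (μ := σ) Metric.isClosed_sphere.measurableSet).mpr hsupp
    have h2 : ∀ᵐ u ∂σ, u ∈ Metric.sphere (0 : EuclideanSpace ℂ (Fin D)) 1 := h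
    simpa using h2
  have hinv' : ∀ s t : EuclideanSpace ℂ (Fin D), ‖s‖ = ‖t‖ → charFun σ s = charFun σ t := by
    intro s t hst
    obtain ⟨U, hU⟩ := exists_unitary s t hst
    let V : EuclideanSpace ℂ (Fin D) ≃ₗᵢ[ℝ] EuclideanSpace ℂ (Fin D) :=
      { U.toLinearEquiv.restrictScalars ℝ with norm_map' := U.norm_map }
    have hV : ∀ x, V x = U x := fun x => rfl
    have h1 : charFun σ t = charFun (σ.map U) t := by rw [hinv U]
    rw [h1, charFun_apply, charFun_apply, integral_map U.continuous.aemeasurable (by fun_prop)]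
    congr 1
    ext x
    rw [← hU, ← hV, ← hV, V.inner_map_map]
  set c := ∫ φ, f φ ∂σ with hcdef
  have hf' : ∀ u v : EuclideanSpace ℂ (Fin D), ‖u‖ = 1 → ‖v‖ = 1 → |f u - f v| ≤ η * ‖u - v‖ :=
    fun u v hu hv => hf u (by simpa using hu) v (by simpa using hv)
  -- integrability of f
  have hfi : Integrable f σ := by
    have hco : ContinuousOn f (Metric.sphere 0 1) :=
      (LipschitzOnWith.of_dist_le_mul (K := Real.toNNReal η) fun x hx y hy => by
        rw [Real.dist_eq, dist_eq_norm, Real.coe_toNNReal _ hη.le]; exact hf x hx y hy).continuousOn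
    have hr : σ.restrict (Metric.sphere 0 1) = σ :=
      Measure.restrict_eq_self_of_ae_mem (by simpa using hs)
    have hm : AEStronglyMeasurable f σ := by
      rw [← hr]
      exact hco.aestronglyMeasurable Metric.isClosed_sphere.measurableSet
    obtain ⟨u₀, hu₀⟩ := hs.exists
    refine (integrable_const (|f u₀| + η * 2)).mono' hm ?_
    filter_upwards [hs] with u hu
    have h1 := hf' u u₀ hu hu₀
    have h2 : ‖u - u₀‖ ≤ 2 := (norm_sub_le _ _).trans (by rw [hu, hu₀]; norm_num)
    have h3 : η * ‖u - u₀‖ ≤ η * 2 := by gcongr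
    have h4 : |f u| ≤ |f u - f u₀| + |f u₀| := by
      have := abs_add_le (f u - f u₀) (f u₀)
      simpa using this
    rw [Real.norm_eq_abs]
    linarith
  set g : EuclideanSpace ℂ (Fin D) → ℝ := fun u => f u - c with hg
  have hgl : ∀ u v : EuclideanSpace ℂ (Fin D), ‖u‖ = 1 → ‖v‖ = 1 → |g u - g v| ≤ η * ‖u - v‖ := by
    intro u v hu hv
    simpa [hg] using hf' u v hu hv
  have hgb : ∀ u : EuclideanSpace ℂ (Fin D), ‖u‖ = 1 → |g u| ≤ 2 * η := by
    intro u hu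
    have e : g u = ∫ v, (f u - f v) ∂σ := by
      rw [integral_sub (integrable_const _) hfi]; simp [hg, hcdef]
    rw [e, ← Real.norm_eq_abs]
    have := norm_integral_le_of_norm_le_const (μ := σ) (f := fun v => f u - f v) (C := 2 * η) (by
      filter_upwards [hs] with v hv
      have h2 : ‖u - v‖ ≤ 2 := (norm_sub_le _ _).trans (by rw [hu, hv]; norm_num)
      rw [Real.norm_eq_abs]
      calc _ ≤ η * ‖u - v‖ := hf' u v hu hv
        _ ≤ η * 2 := by gcongr
        _ = _ := by ring)
    simpa using this
  have hgm : ∫ u, g u ∂σ = 0 := by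
    rw [hg, integral_sub hfi (integrable_const _)]; simp [hcdef]
  set F : EuclideanSpace ℂ (Fin D) → ℝ := fun x => ‖x‖ * g (‖x‖⁻¹ • x) with hFdef
  have hFl := homog_lipschitz g η hη hgl hgb
  have hFg : ∀ u, ‖u‖ = 1 → F u = g u := fun u hu => by simp [hFdef, hu]
  have hFm : ∫ u, F u ∂σ = 0 := by
    rw [← hgm]
    refine integral_congr_ae ?_
    filter_upwards [hs] with u hu using hFg u hu
  have hhom : ∀ (r : ℝ) (u : EuclideanSpace ℂ (Fin D)), 0 ≤ r → F (r • u) = r * F u := by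
    intro r u hr
    rcases hr.eq_or_lt with h0 | h0
    · simp [hFdef, ← h0]
    · simp only [hFdef, norm_smul, Real.norm_eq_abs, abs_of_pos h0]
      rw [mul_assoc, mul_inv, smul_smul]
      congr 4
      field_simp
  have hC : 0 < Real.toNNReal (√5 * η) := by
    rw [Real.toNNReal_pos]; positivity
  have t1 := sphere_tail σ hs hinv' F _ hC hFl hhom hFm δ hδ
  have t2 := sphere_tail σ hs hinv' (fun x => -F x) _ hC hFl.neg
    (fun r u hr => by rw [hhom r u hr]; ring) (by rw [integral_neg, hFm, neg_zero]) δ hδ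
  have hmean := norm_mean (E := EuclideanSpace ℂ (Fin D))
  have hfr : Module.finrank ℝ (EuclideanSpace ℂ (Fin D)) = 2 * D := by
    rw [← Module.finrank_mul_finrank ℝ ℂ (EuclideanSpace ℂ (Fin D))]
    simp
  rw [hfr] at hmean
  set m := ∫ x, ‖x‖ ∂(stdGaussian (EuclideanSpace ℂ (Fin D))) with hmdef
  have hexp : Real.exp (-(2 * m^2 * δ^2 / (Real.pi^2 * (Real.toNNReal (√5 * η) : ℝ)^2))) ≤
      Real.exp (-(2 * D * δ ^ 2) / (9 * Real.pi ^ 3 * Real.log 2 * η ^ 2)) := by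
    refine Real.exp_le_exp.mpr ?_
    rw [Real.coe_toNNReal _ (by positivity), mul_pow, Real.sq_sqrt (by norm_num), neg_div, neg_le_neg_iff]
    have hpi := Real.pi_gt_d2
    have hl := Real.log_two_gt_d9
    have hpl : (2.17 : ℝ) ≤ Real.pi * Real.log 2 := by nlinarith
    push_cast at hmean
    have hD0 : (0:ℝ) ≤ D := by positivity
    have hk : 5 * (D:ℝ) ≤ 9 * (Real.pi * Real.log 2) * m^2 := by
      have : 9 * 2.17 * (0.39 ^ 2 * (2 * (D:ℝ))) ≤ 9 * (Real.pi * Real.log 2) * m^2 := by gcongr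
      linarith
    have hl0 : 0 < Real.log 2 := by linarith
    have hp0 := Real.pi_pos
    rw [div_le_div_iff₀ (by positivity) (by positivity)]
    have := mul_le_mul_of_nonneg_left hk (show 0 ≤ 2 * δ^2 * Real.pi^2 * η^2 by positivity)
    nlinarith
  have hsub : σ.real {ψ | δ ≤ |f ψ - c|} ≤ σ.real ({u | δ ≤ F u} ∪ {u | δ ≤ -F u}) := by
    refine ENNReal.toReal_mono (measure_ne_top _ _) (measure_mono_ae ?_)
    filter_upwards [hs] with u hu
    intro (h : δ ≤ |f u - c|)
    show δ ≤ F u ∨ δ ≤ -F u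
    rw [hFg u hu]
    exact le_abs.mp h
  change σ.real {ψ | δ ≤ |f ψ - c|} ≤ _
  have hun := measureReal_union_le (μ := σ) {u | δ ≤ F u} {u | δ ≤ -F u}
  linarith [t1.trans hexp, t2.trans hexp]
end

section
/- (Theorem 1, geometric-entanglement form with explicit constants.) Let d ≥ 2 and N ≥ 1 be integers, and let σ be the unitarily invariant (uniform) probability measure on the unit sphere of the N-qudit Hilbert space (of total dimension d^N). Then the probability that a σ-random pure state ψ has a product state u with |⟨u, ψ⟩|² ≥ N²/d^N (equivalently, geometric entanglement E_g(ψ) ≤ N·ln d − 2·ln N) is at most 2 · exp(2·d·N·(ln N + 3)) · exp(−C₁·N²/16), where C₁ = 2/(9·π³·ln 2). In particular this probability is e^{−O(N²)}. -/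
open MeasureTheory
open scoped ComplexInnerProductSpace

/-- An `N`-qudit product state (local dimension `d`): a vector of the form
`u x = ∏ i, f i (x i)` where each local vector `f i : Fin d → ℂ` is a unit vector. -/
def IsProductState (d N : ℕ) (u : EuclideanSpace ℂ (Fin N → Fin d)) : Prop :=
  ∃ f : Fin N → Fin d → ℂ,
    (∀ i, ∑ a, ‖f i a‖ ^ 2 = 1) ∧ ∀ x, u x = ∏ i, f i (x i)


section Gauss
variable {ι : Type} [Fintype ι]

/-- Reference Lebesgue measure on `ℂ^ι`. -/
noncomputable def refMeasure (ι : Type) [Fintype ι] : Measure (EuclideanSpace ℂ ι) :=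
  (volume : Measure (ι → ℂ)).map (WithLp.toLp 2)

lemma refMeasure_inv (U : EuclideanSpace ℂ ι ≃ₗᵢ[ℂ] EuclideanSpace ℂ ι) :
    (refMeasure ι).map U = refMeasure ι := by
  have : (refMeasure ι).IsAddHaarMeasure :=
    (PiLp.continuousLinearEquiv 2 ℝ (fun _ : ι => ℂ)).symm.isAddHaarMeasure_map volume
  have h := Measure.isAddLeftInvariant_eq_smul (refMeasure ι) (volume : Measure (EuclideanSpace ℂ ι))
  rw [h, Measure.map_smul]
  congr 1
  let V : EuclideanSpace ℂ ι ≃ₗᵢ[ℝ] EuclideanSpace ℂ ι :=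
    { U.toLinearEquiv.restrictScalars ℝ with norm_map' := U.norm_map }
  exact V.measurePreserving.map_eq

lemma cplx_moment (k : ℕ) :
    Integrable (fun z : ℂ => ‖z‖ ^ (2 * k) * Real.exp (-‖z‖ ^ 2)) ∧
    ∫ z : ℂ, ‖z‖ ^ (2 * k) * Real.exp (-‖z‖ ^ 2) = Real.pi * k.factorial := by
  have h := Complex.integral_rpow_mul_exp_neg_rpow (p := 2) (q := 2 * k) (by norm_num)
    (by have : (0:ℝ) ≤ k := k.cast_nonneg
        linarith)
  have e : ((2 * (k:ℝ) + 2) / 2) = k + 1 := by ring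
  rw [e, Real.Gamma_nat_eq_factorial] at h
  have h2 : ∫ z : ℂ, ‖z‖ ^ (2 * k) * Real.exp (-‖z‖ ^ 2) = Real.pi * k.factorial := by
    rw [← show 2 * Real.pi / 2 * (k.factorial : ℝ) = Real.pi * k.factorial by ring, ← h]
    congr 1
    ext z
    rw [← Real.rpow_natCast, ← Real.rpow_natCast]
    push_cast
    rfl
  refine ⟨?_, h2⟩
  by_contra hc
  rw [integral_undef hc] at h2
  have : 0 < Real.pi * k.factorial := by positivity
  linarith

lemma gauss_moment (i : ι) (k : ℕ) :
    ∫⁻ z, ENNReal.ofReal (‖z i‖ ^ (2 * k) * Real.exp (-‖z‖ ^ 2)) ∂(refMeasure ι) =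
      ENNReal.ofReal (k.factorial * Real.pi ^ Fintype.card ι) := by
  classical
  rw [refMeasure, lintegral_map (by fun_prop) (by fun_prop)]
  have e : ∀ z : ι → ℂ, ‖(WithLp.toLp 2 z : EuclideanSpace ℂ ι) i‖ ^ (2 * k) *
      Real.exp (-‖(WithLp.toLp 2 z : EuclideanSpace ℂ ι)‖ ^ 2) =
      ∏ j, ‖z j‖ ^ (2 * (if j = i then k else 0)) * Real.exp (-‖z j‖ ^ 2) := by
    intro z
    rw [Finset.prod_mul_distrib, ← Real.exp_sum, EuclideanSpace.norm_sq_eq,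
      Finset.prod_eq_single i]
    · simp
    · intro b _ hb
      simp [hb]
    · simp
  simp_rw [e]
  rw [← ofReal_integral_eq_lintegral_ofReal]
  · rw [integral_fintype_prod_volume_eq_prod (𝕜 := ℝ) (fun j (z : ℂ) =>
      ‖z‖ ^ (2 * (if j = i then k else 0)) * Real.exp (-‖z‖ ^ 2))]
    congr 1
    simp_rw [(cplx_moment _).2]
    rw [Finset.prod_mul_distrib, mul_comm, Finset.prod_eq_single i]
    · simp
    · intro b _ hb
      simp [hb]
    · simp
  · exact Integrable.fintype_prod (f := fun j (z : ℂ) =>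
      ‖z‖ ^ (2 * (if j = i then k else 0)) * Real.exp (-‖z‖ ^ 2)) (fun j => (cplx_moment _).1)
  · exact Filter.Eventually.of_forall fun z => Finset.prod_nonneg fun j _ => by positivity

lemma exists_unitary_s5 (i : ι) (w : EuclideanSpace ℂ ι) (hw : ‖w‖ = 1) :
    ∃ U : EuclideanSpace ℂ ι ≃ₗᵢ[ℂ] EuclideanSpace ℂ ι, ∀ ψ, ⟪w, ψ⟫ = (U ψ) i := by
  obtain ⟨b, hb⟩ := Orthonormal.exists_orthonormalBasis_extension_of_card_eq (𝕜 := ℂ)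
    (E := EuclideanSpace ℂ ι) (ι := ι) (by simp) (v := fun _ => w) (s := {i}) (by
      constructor
      · intro j; simpa using hw
      · intro a b hab
        exact absurd (Subsingleton.elim a b) hab)
  refine ⟨b.repr, fun ψ => ?_⟩
  rw [b.repr_apply_apply, hb i rfl]

lemma lintegral_coord {μ : Measure (EuclideanSpace ℂ ι)}
    (hinv : ∀ U : EuclideanSpace ℂ ι ≃ₗᵢ[ℂ] EuclideanSpace ℂ ι, μ.map U = μ)
    (i : ι) (w : EuclideanSpace ℂ ι) (hw : ‖w‖ = 1) (k : ℕ) (ρ : ℝ → ℝ) (hρ : Measurable ρ) :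
    ∫⁻ z, ENNReal.ofReal (‖⟪w, z⟫‖ ^ (2 * k) * ρ ‖z‖) ∂μ =
      ∫⁻ z, ENNReal.ofReal (‖z i‖ ^ (2 * k) * ρ ‖z‖) ∂μ := by
  obtain ⟨U, hU⟩ := exists_unitary_s5 i w hw
  conv_rhs => rw [← hinv U]
  rw [lintegral_map (by fun_prop) (by fun_prop)]
  simp [hU]

lemma gauss_norm [Nonempty ι] (k : ℕ) :
    ENNReal.ofReal ((Fintype.card ι : ℝ) ^ k * Real.pi ^ Fintype.card ι) ≤
    ∫⁻ z, ENNReal.ofReal (‖z‖ ^ (2 * k) * Real.exp (-‖z‖ ^ 2)) ∂(refMeasure ι) := by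
  have hD : (0:ℝ) < Fintype.card ι := by exact_mod_cast Fintype.card_pos
  set D : ℝ := (Fintype.card ι : ℝ) with hDdef
  obtain ⟨i0⟩ := ‹Nonempty ι›
  have h0 := gauss_moment i0 0
  simp only [mul_zero, pow_zero, one_mul, Nat.factorial_zero, Nat.cast_one] at h0
  have h1 : ∫⁻ z, ENNReal.ofReal (‖z‖ ^ 2 * Real.exp (-‖z‖ ^ 2)) ∂(refMeasure ι) =
      ENNReal.ofReal (D * Real.pi ^ Fintype.card ι) := by
    have : ∀ z : EuclideanSpace ℂ ι, ENNReal.ofReal (‖z‖ ^ 2 * Real.exp (-‖z‖ ^ 2)) =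
        ∑ j, ENNReal.ofReal (‖z j‖ ^ (2 * 1) * Real.exp (-‖z‖ ^ 2)) := by
      intro z
      rw [← ENNReal.ofReal_sum_of_nonneg (fun _ _ => by positivity), ← Finset.sum_mul,
        EuclideanSpace.norm_sq_eq z]
    simp_rw [this]
    rw [lintegral_finsetSum _ (fun _ _ => by fun_prop)]
    simp_rw [gauss_moment]
    rw [← ENNReal.ofReal_sum_of_nonneg (fun _ _ => by positivity)]
    simp [hDdef]
  have key : ∀ z : EuclideanSpace ℂ ι,
      ENNReal.ofReal (D ^ k) * ENNReal.ofReal (Real.exp (-‖z‖ ^ 2)) +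
        ENNReal.ofReal (k * D ^ k / D) * ENNReal.ofReal (‖z‖ ^ 2 * Real.exp (-‖z‖ ^ 2)) ≤
      ENNReal.ofReal (‖z‖ ^ (2 * k) * Real.exp (-‖z‖ ^ 2)) +
        ENNReal.ofReal (k * D ^ k) * ENNReal.ofReal (Real.exp (-‖z‖ ^ 2)) := by
    intro z
    rw [← ENNReal.ofReal_mul (by positivity), ← ENNReal.ofReal_mul (by positivity),
      ← ENNReal.ofReal_mul (by positivity), ← ENNReal.ofReal_add (by positivity) (by positivity),
      ← ENNReal.ofReal_add (by positivity) (by positivity)]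
    apply ENNReal.ofReal_le_ofReal
    have hb := one_add_mul_le_pow (a := ‖z‖ ^ 2 / D - 1)
      (by have : 0 ≤ ‖z‖ ^ 2 / D := by positivity
          linarith) k
    rw [add_sub_cancel, div_pow, le_div_iff₀ (by positivity), ← pow_mul] at hb
    have := mul_le_mul_of_nonneg_right hb (Real.exp_pos (-‖z‖ ^ 2)).le
    calc _ = (1 + k * (‖z‖ ^ 2 / D - 1)) * D ^ k * Real.exp (-‖z‖ ^ 2)
          + k * D ^ k * Real.exp (-‖z‖ ^ 2) := by field_simp; ring
      _ ≤ _ := by linarith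
  have hi := lintegral_mono (μ := refMeasure ι) key
  rw [lintegral_add_left (by fun_prop), lintegral_add_left (by fun_prop),
    lintegral_const_mul _ (by fun_prop), lintegral_const_mul _ (by fun_prop),
    lintegral_const_mul _ (by fun_prop), h0, h1, ← ENNReal.ofReal_mul (by positivity),
    ← ENNReal.ofReal_mul (by positivity), ← ENNReal.ofReal_mul (by positivity)] at hi
  rw [show k * D ^ k / D * (D * Real.pi ^ Fintype.card ι) = k * D ^ k * Real.pi ^ Fintype.card ι by
    field_simp] at hi
  exact (ENNReal.add_le_add_iff_right ENNReal.ofReal_ne_top).1 hi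

lemma sphere_moment [Nonempty ι] (σ : Measure (EuclideanSpace ℂ ι)) [IsProbabilityMeasure σ]
    (hsupp : σ (Metric.sphere (0 : EuclideanSpace ℂ ι) 1) = 1)
    (hinv : ∀ U : EuclideanSpace ℂ ι ≃ₗᵢ[ℂ] EuclideanSpace ℂ ι, σ.map U = σ)
    (i : ι) (k : ℕ) :
    ∫⁻ ψ, ENNReal.ofReal (‖ψ i‖ ^ (2 * k)) ∂σ ≤
      ENNReal.ofReal (k.factorial / (Fintype.card ι : ℝ) ^ k) := by
  have hD : (0:ℝ) < Fintype.card ι := by exact_mod_cast Fintype.card_pos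
  have hae : ∀ᵐ ψ ∂σ, ‖ψ‖ = 1 := by
    have := (prob_compl_eq_zero_iff (μ := σ) (Metric.isClosed_sphere.measurableSet)).2 hsupp
    filter_upwards [compl_mem_ae_iff.2 this] with ψ hψ
    simpa using hψ
  have : SFinite (refMeasure ι) := by unfold refMeasure; infer_instance
  set M := ∫⁻ ψ, ENNReal.ofReal (‖ψ i‖ ^ (2 * k)) ∂σ with hM
  -- integrate over `ψ` first
  have hA : ∀ z : EuclideanSpace ℂ ι, ∫⁻ ψ, ENNReal.ofReal (‖⟪z, ψ⟫‖ ^ (2 * k)) ∂σ =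
      ENNReal.ofReal (‖z‖ ^ (2 * k)) * M := by
    intro z
    by_cases hz : z = 0
    · subst hz
      rcases Nat.eq_zero_or_pos k with rfl | hk
      · simp [hM]
      · simp [hk.ne']
    · have hz' : ‖z‖ ≠ 0 := norm_ne_zero_iff.2 hz
      have h1 := lintegral_coord hinv i ((‖z‖⁻¹ : ℂ) • z)
        (by simp [norm_smul, hz']) k (fun _ => 1) (by fun_prop)
      simp only [mul_one] at h1
      rw [hM, ← h1, ← lintegral_const_mul _ (by fun_prop)]
      congr 1
      ext ψ
      rw [← ENNReal.ofReal_mul (by positivity), inner_smul_left, norm_mul, mul_pow, ← mul_assoc]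
      simp [hz']
  have hB : ∀ ψ : EuclideanSpace ℂ ι, ‖ψ‖ = 1 →
      ∫⁻ z, ENNReal.ofReal (‖⟪z, ψ⟫‖ ^ (2 * k) * Real.exp (-‖z‖ ^ 2)) ∂(refMeasure ι) =
      ENNReal.ofReal (k.factorial * Real.pi ^ Fintype.card ι) := by
    intro ψ hψ
    rw [← gauss_moment i k, ← lintegral_coord refMeasure_inv i ψ hψ k
      (fun r => Real.exp (- r ^ 2)) (by fun_prop)]
    simp_rw [norm_inner_symm ψ]
  have hswap := lintegral_lintegral_swap (μ := refMeasure ι) (ν := σ)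
    (f := fun z ψ => ENNReal.ofReal (‖⟪z, ψ⟫‖ ^ (2 * k) * Real.exp (-‖z‖ ^ 2)))
    (by
      apply Measurable.aemeasurable
      apply ENNReal.measurable_ofReal.comp
      apply Continuous.measurable
      fun_prop)
  have hR : ∫⁻ ψ, ∫⁻ z, ENNReal.ofReal (‖⟪z, ψ⟫‖ ^ (2 * k) * Real.exp (-‖z‖ ^ 2)) ∂(refMeasure ι) ∂σ
      = ENNReal.ofReal (k.factorial * Real.pi ^ Fintype.card ι) := by
    rw [lintegral_congr_ae (hae.mono hB)]
    simp
  have hL : ∫⁻ z, ∫⁻ ψ, ENNReal.ofReal (‖⟪z, ψ⟫‖ ^ (2 * k) * Real.exp (-‖z‖ ^ 2)) ∂σ ∂(refMeasure ι)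
      = (∫⁻ z, ENNReal.ofReal (‖z‖ ^ (2 * k) * Real.exp (-‖z‖ ^ 2)) ∂(refMeasure ι)) * M := by
    rw [← lintegral_mul_const _ (by fun_prop)]
    congr 1
    ext z
    simp_rw [ENNReal.ofReal_mul (show 0 ≤ ‖⟪z, _⟫‖ ^ (2 * k) by positivity)]
    rw [lintegral_mul_const _ (by fun_prop), hA, ENNReal.ofReal_mul (by positivity)]
    ring
  rw [hL, hR] at hswap
  have h2 : ENNReal.ofReal ((Fintype.card ι : ℝ) ^ k * Real.pi ^ Fintype.card ι) * M ≤
      ENNReal.ofReal (k.factorial * Real.pi ^ Fintype.card ι) := by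
    rw [← hswap]
    gcongr
    exact gauss_norm k
  have h3 : M ≤ ENNReal.ofReal (k.factorial * Real.pi ^ Fintype.card ι) /
      ENNReal.ofReal ((Fintype.card ι : ℝ) ^ k * Real.pi ^ Fintype.card ι) := by
    rw [ENNReal.le_div_iff_mul_le, mul_comm]
    · exact h2
    · left
      have : 0 < (Fintype.card ι : ℝ) ^ k * Real.pi ^ Fintype.card ι := by positivity
      exact (ENNReal.ofReal_pos.2 this).ne'
    · left
      exact ENNReal.ofReal_ne_top
  rw [← ENNReal.ofReal_div_of_pos (by positivity)] at h3
  convert h3 using 2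
  field_simp

lemma sphere_tail_s5 [Nonempty ι] (σ : Measure (EuclideanSpace ℂ ι)) [IsProbabilityMeasure σ]
    (hsupp : σ (Metric.sphere (0 : EuclideanSpace ℂ ι) 1) = 1)
    (hinv : ∀ U : EuclideanSpace ℂ ι ≃ₗᵢ[ℂ] EuclideanSpace ℂ ι, σ.map U = σ)
    (w : EuclideanSpace ℂ ι) (hw : ‖w‖ = 1) (k : ℕ) (t : ℝ) (ht : 0 < t) :
    σ {ψ | t ≤ ‖⟪w, ψ⟫‖ ^ 2} ≤
      ENNReal.ofReal (k.factorial / ((Fintype.card ι : ℝ) * t) ^ k) := by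
  obtain ⟨i⟩ := ‹Nonempty ι›
  have h := sphere_moment (ι := ι) σ hsupp hinv i k
  have h1 := lintegral_coord hinv i w hw k (fun _ => 1) (by fun_prop)
  simp only [mul_one] at h1
  rw [← h1] at h
  have hm := mul_meas_ge_le_lintegral (μ := σ)
    (f := fun ψ => ENNReal.ofReal (‖⟪w, ψ⟫‖ ^ (2 * k))) (by fun_prop) (ENNReal.ofReal (t ^ k))
  have hsub : {ψ : EuclideanSpace ℂ ι | t ≤ ‖⟪w, ψ⟫‖ ^ 2} ⊆
      {ψ | ENNReal.ofReal (t ^ k) ≤ ENNReal.ofReal (‖⟪w, ψ⟫‖ ^ (2 * k))} := by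
    intro ψ hψ
    apply ENNReal.ofReal_le_ofReal
    rw [pow_mul]
    exact pow_le_pow_left₀ ht.le hψ k
  refine (measure_mono hsub).trans ?_
  have h3 := hm.trans h
  rw [mul_comm, ← ENNReal.le_div_iff_mul_le (by left; simpa using pow_pos ht k) (by simp),
    ← ENNReal.ofReal_div_of_pos (by positivity)] at h3
  rwa [div_div, ← mul_pow] at h3

end Gauss


section Net

/-- Grid point in `ℂ^d` with mesh `1 / N`. -/
noncomputable def gridVec (d N : ℕ) (g : Fin d → Fin (2 * N + 1) × Fin (2 * N + 1)) :
    EuclideanSpace ℂ (Fin d) :=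
  WithLp.toLp 2 fun a =>
    ⟨(((g a).1 : ℕ) - (N : ℝ)) / N, (((g a).2 : ℕ) - (N : ℝ)) / N⟩

open Classical in
/-- Normalized grid point (with an arbitrary unit vector in place of `0`). -/
noncomputable def netVec (d N : ℕ) (hd : 0 < d)
    (g : Fin d → Fin (2 * N + 1) × Fin (2 * N + 1)) : EuclideanSpace ℂ (Fin d) :=
  if gridVec d N g = 0 then EuclideanSpace.single ⟨0, hd⟩ 1
  else ((‖gridVec d N g‖ : ℂ)⁻¹) • gridVec d N g

lemma netVec_norm (d N : ℕ) (hd : 0 < d) (g) : ‖netVec d N hd g‖ = 1 := by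
  unfold netVec
  split_ifs with h
  · simp
  · have : ‖gridVec d N g‖ ≠ 0 := norm_ne_zero_iff.2 h
    simp [norm_smul, this]

lemma exists_round (N : ℕ) (hN : 1 ≤ N) (x : ℝ) (hx : |x| ≤ 1) :
    ∃ m : Fin (2 * N + 1), (x - ((m : ℕ) - (N : ℝ)) / N) ^ 2 ≤ 1 / (N : ℝ) ^ 2 := by
  have hN' : (0:ℝ) < N := by exact_mod_cast hN
  rw [abs_le] at hx
  have h0 : 0 ≤ N * (x + 1) := by
    have : 0 ≤ x + 1 := by linarith
    positivity
  refine ⟨⟨⌊N * (x + 1)⌋₊, ?_⟩, ?_⟩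
  · rw [Nat.floor_lt h0]
    push_cast
    nlinarith
  · have h1 := Nat.floor_le h0
    have h2 := Nat.lt_floor_add_one (N * (x + 1))
    simp only
    set m : ℝ := (⌊N * (x + 1)⌋₊ : ℝ)
    have : x - (m - N) / N = (N * (x + 1) - m) / N := by field_simp; ring
    rw [this, div_pow]
    gcongr
    nlinarith

lemma exists_grid (d N : ℕ) (hN : 1 ≤ N) (v : EuclideanSpace ℂ (Fin d)) (hv : ‖v‖ = 1) :
    ∃ g, ‖v - gridVec d N g‖ ^ 2 ≤ 2 * d / (N : ℝ) ^ 2 := by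
  have hc : ∀ a, ‖v a‖ ≤ 1 := fun a => hv ▸ PiLp.norm_apply_le v a
  choose p hp using fun a => exists_round N hN (v a).re ((Complex.abs_re_le_norm _).trans (hc a))
  choose q hq using fun a => exists_round N hN (v a).im ((Complex.abs_im_le_norm _).trans (hc a))
  refine ⟨fun a => (p a, q a), ?_⟩
  rw [EuclideanSpace.norm_sq_eq]
  calc _ ≤ ∑ a : Fin d, 2 / (N : ℝ) ^ 2 := by
        apply Finset.sum_le_sum
        intro a _
        rw [← Complex.normSq_eq_norm_sq, Complex.normSq_apply]
        have h1 := hp a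
        have h2 := hq a
        simp only [gridVec, PiLp.sub_apply, Complex.sub_re, Complex.sub_im]
        rw [← sq, ← sq]
        calc _ ≤ 1 / (N : ℝ) ^ 2 + 1 / (N : ℝ) ^ 2 := add_le_add h1 h2
          _ = _ := by ring
    _ = _ := by simp; ring

lemma exists_net (d N : ℕ) (hd : 0 < d) (hN : 4 * d ≤ N) (v : EuclideanSpace ℂ (Fin d))
    (hv : ‖v‖ = 1) : ∃ g, 1 - 1 / (2 * N : ℝ) ≤ ‖⟪v, netVec d N hd g⟫‖ ^ 2 := by
  have hN1 : 1 ≤ N := by omega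
  have hNr : (1:ℝ) ≤ N := by exact_mod_cast hN1
  have h4 : (4:ℝ) * d ≤ N := by exact_mod_cast hN
  obtain ⟨g, hg⟩ := exists_grid d N hN1 v hv
  have hg' : ‖v - gridVec d N g‖ ^ 2 ≤ 1 / (2 * N) := by
    refine hg.trans ?_
    rw [div_le_div_iff₀ (by positivity) (by positivity)]
    nlinarith
  have hlt : 1 / (2 * N : ℝ) < 1 := by
    rw [div_lt_one (by positivity)]; linarith
  have hne : gridVec d N g ≠ 0 := by
    intro h
    rw [h, sub_zero, hv] at hg'
    linarith
  refine ⟨g, ?_⟩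
  rw [netVec, if_neg hne]
  set w := gridVec d N g
  set δ := 1 / (2 * N : ℝ)
  have hw : 0 < ‖w‖ := norm_pos_iff.2 hne
  have e := @norm_sub_sq ℂ _ _ _ _ v w
  rw [hv] at e
  rw [inner_smul_right, norm_mul, mul_pow]
  have hre : (RCLike.re ⟪v, w⟫ : ℝ) ≤ ‖⟪v, w⟫‖ := Complex.re_le_norm _
  have h2 : (1 - δ) + ‖w‖ ^ 2 ≤ 2 * ‖⟪v, w⟫‖ := by
    change _ = _ - 2 * (RCLike.re ⟪v, w⟫ : ℝ) + _ at e
    linarith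
  have h3 : (1 - δ) * ‖w‖ ^ 2 ≤ ‖⟪v, w⟫‖ ^ 2 := by
    have : 0 ≤ 1 - δ := by linarith
    nlinarith [sq_nonneg ((1 - δ) - ‖w‖ ^ 2), sq_nonneg (‖w‖)]
  have h4 : ‖((‖w‖ : ℂ))⁻¹‖ ^ 2 = (‖w‖ ^ 2)⁻¹ := by simp
  rw [h4, inv_mul_eq_div, le_div_iff₀ (by positivity)]
  exact h3

lemma site_step (d N : ℕ) (hd : 0 < d) (hN : 4 * d ≤ N) (c f : Fin d → ℂ)
    (hf : ∑ a, ‖f a‖ ^ 2 = 1) :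
    ∃ g, (1 - 1 / (2 * N : ℝ)) * ‖∑ a, c a * f a‖ ^ 2 ≤ ‖∑ a, c a * netVec d N hd g a‖ ^ 2 := by
  let C : EuclideanSpace ℂ (Fin d) := WithLp.toLp 2 fun a => starRingEnd ℂ (c a)
  have hin : ∀ z : EuclideanSpace ℂ (Fin d), ∑ a, c a * z a = ⟪C, z⟫ := by
    intro z
    rw [PiLp.inner_apply]
    apply Finset.sum_congr rfl
    intro a _
    simp [C, mul_comm]
  have hF := hin (WithLp.toLp 2 f)
  simp only at hF
  have hFn : ‖(WithLp.toLp 2 f : EuclideanSpace ℂ (Fin d))‖ = 1 := by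
    rw [EuclideanSpace.norm_eq]; simp [hf]
  by_cases hC : C = 0
  · refine ⟨fun _ => (0, 0), ?_⟩
    rw [hF, hC]
    rw [inner_zero_left, norm_zero, zero_pow two_ne_zero, mul_zero]
    positivity
  have hCn : ‖C‖ ≠ 0 := norm_ne_zero_iff.2 hC
  obtain ⟨g, hg⟩ := exists_net d N hd hN (((‖C‖ : ℂ)⁻¹) • C) (by simp [norm_smul, hCn])
  refine ⟨g, ?_⟩
  rw [hF, hin]
  rw [inner_smul_left, norm_mul, mul_pow] at hg
  have h4 : ‖starRingEnd ℂ ((‖C‖ : ℂ))⁻¹‖ ^ 2 = (‖C‖ ^ 2)⁻¹ := by simp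
  rw [h4, inv_mul_eq_div, le_div_iff₀ (by positivity)] at hg
  refine le_trans ?_ hg
  have := norm_inner_le_norm (𝕜 := ℂ) C (WithLp.toLp 2 f)
  rw [hFn, mul_one] at this
  have h1 : 0 ≤ 1 - 1 / (2 * N : ℝ) := by
    have hNr : (1:ℝ) ≤ N := by exact_mod_cast (show 1 ≤ N by omega)
    rw [sub_nonneg, div_le_one (by positivity)]; linarith
  gcongr

lemma update_sum {d N : ℕ} (φ : (Fin N → Fin d) → ℂ) (f : Fin N → Fin d → ℂ) (i : Fin N) :
    ∃ c : Fin d → ℂ, ∀ h : Fin d → ℂ,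
      ∑ x, (∏ j, Function.update f i h j (x j)) * φ x = ∑ a, c a * h a := by
  refine ⟨fun a => ∑ x, if x i = a then (∏ j ∈ Finset.univ.erase i, f j (x j)) * φ x else 0, ?_⟩
  intro h
  simp_rw [Finset.sum_mul]
  rw [Finset.sum_comm]
  apply Finset.sum_congr rfl
  intro x _
  simp only [ite_mul, zero_mul, Finset.sum_ite_eq, Finset.mem_univ, if_true]
  rw [← Finset.mul_prod_erase _ _ (Finset.mem_univ i)]
  have : ∏ j ∈ Finset.univ.erase i, Function.update f i h j (x j) =
      ∏ j ∈ Finset.univ.erase i, f j (x j) := by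
    apply Finset.prod_congr rfl
    intro j hj
    rw [Function.update_of_ne (Finset.ne_of_mem_erase hj)]
  rw [this]
  simp
  ring

lemma exists_product_net (d N : ℕ) (hd : 0 < d) (hN : 4 * d ≤ N) (φ : (Fin N → Fin d) → ℂ)
    (f : Fin N → Fin d → ℂ) (hf : ∀ i, ∑ a, ‖f i a‖ ^ 2 = 1) (s : Finset (Fin N)) :
    ∃ f' : Fin N → Fin d → ℂ, (∀ i, ∑ a, ‖f' i a‖ ^ 2 = 1) ∧
      (∀ i ∈ s, ∃ g, f' i = (netVec d N hd g).ofLp) ∧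
      (1 - 1 / (2 * N : ℝ)) ^ s.card * ‖∑ x, (∏ j, f j (x j)) * φ x‖ ^ 2 ≤
        ‖∑ x, (∏ j, f' j (x j)) * φ x‖ ^ 2 := by
  induction s using Finset.induction_on with
  | empty => exact ⟨f, hf, by simp, by simp⟩
  | insert i s his ih =>
    obtain ⟨f', hf', hs, hb⟩ := ih
    obtain ⟨c, hc⟩ := update_sum φ f' i
    obtain ⟨g, hg⟩ := site_step d N hd hN c (f' i) (hf' i)
    refine ⟨Function.update f' i (netVec d N hd g).ofLp, ?_, ?_, ?_⟩
    · intro j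
      by_cases hj : j = i
      · subst hj
        simp only [Function.update_self]
        rw [← EuclideanSpace.norm_sq_eq, netVec_norm, one_pow]
      · simp only [Function.update_of_ne hj]
        exact hf' j
    · intro j hj
      by_cases hji : j = i
      · subst hji
        exact ⟨g, by simp⟩
      · obtain ⟨g', hg'⟩ := hs j (Finset.mem_of_mem_insert_of_ne hj hji)
        exact ⟨g', by rw [Function.update_of_ne hji, hg']⟩
    · rw [hc, Finset.card_insert_of_notMem his, pow_succ', mul_assoc]
      refine le_trans ?_ hg
      have := hc (f' i)
      rw [Function.update_eq_self] at this
      rw [← this]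
      have h1 : 0 ≤ 1 - 1 / (2 * N : ℝ) := by
        have hNr : (1:ℝ) ≤ N := by exact_mod_cast (show 1 ≤ N by omega)
        rw [sub_nonneg, div_le_one (by positivity)]; linarith
      gcongr

/-- Product of the local vectors. -/
noncomputable def prodVec {d N : ℕ} (f : Fin N → Fin d → ℂ) : EuclideanSpace ℂ (Fin N → Fin d) :=
  WithLp.toLp 2 fun x => ∏ i, f i (x i)

lemma prodVec_norm {d N : ℕ} (f : Fin N → Fin d → ℂ) (hf : ∀ i, ∑ a, ‖f i a‖ ^ 2 = 1) :
    ‖prodVec f‖ = 1 := by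
  have : ‖prodVec f‖ ^ 2 = 1 := by
    rw [EuclideanSpace.norm_sq_eq]
    simp only [prodVec, norm_prod, ← Finset.prod_pow]
    have := Finset.prod_univ_sum (fun _ : Fin N => (Finset.univ : Finset (Fin d)))
      (fun i a => ‖f i a‖ ^ 2)
    rw [Fintype.piFinset_univ] at this
    rw [← this]
    simp [hf]
  nlinarith [norm_nonneg (prodVec f)]

lemma prodVec_inner {d N : ℕ} (f : Fin N → Fin d → ℂ) (ψ : EuclideanSpace ℂ (Fin N → Fin d)) :
    ‖⟪prodVec f, ψ⟫‖ = ‖∑ x, (∏ j, f j (x j)) * starRingEnd ℂ (ψ x)‖ := by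
  rw [norm_inner_symm, PiLp.inner_apply]
  congr 1

lemma net_cover (d N : ℕ) (hd : 0 < d) (hN : 4 * d ≤ N) (f : Fin N → Fin d → ℂ)
    (hf : ∀ i, ∑ a, ‖f i a‖ ^ 2 = 1) (ψ : EuclideanSpace ℂ (Fin N → Fin d)) :
    ∃ G : Fin N → Fin d → Fin (2 * N + 1) × Fin (2 * N + 1),
      1 / 2 * ‖⟪prodVec f, ψ⟫‖ ^ 2 ≤
        ‖⟪prodVec (fun i => (netVec d N hd (G i)).ofLp), ψ⟫‖ ^ 2 := by
  obtain ⟨f', _, hs, hb⟩ := exists_product_net d N hd hN (fun x => starRingEnd ℂ (ψ x)) f hf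
    Finset.univ
  choose G hG using fun i => hs i (Finset.mem_univ i)
  refine ⟨G, ?_⟩
  have : f' = fun i => (netVec d N hd (G i)).ofLp := funext hG
  rw [← this, prodVec_inner, prodVec_inner]
  refine le_trans ?_ hb
  have hNr : (1:ℝ) ≤ N := by exact_mod_cast (show 1 ≤ N by omega)
  have hB := one_add_mul_le_pow (a := -(1 / (2 * N : ℝ)))
    (by
      have : 1 / (2 * N : ℝ) ≤ 1 := by rw [div_le_one (by positivity)]; linarith
      linarith) N
  have e : 1 + (N:ℝ) * -(1 / (2 * N : ℝ)) = 1 / 2 := by field_simp; norm_num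
  rw [e, ← sub_eq_add_neg] at hB
  rw [Finset.card_univ, Fintype.card_fin]
  gcongr

end Net

lemma numeric_const : 2 / (9 * Real.pi ^ 3 * Real.log 2) / 16 ≤ 1 / 8 := by
  have h1 := Real.pi_gt_three
  have h2 := Real.log_two_gt_d9
  have h3 : (3:ℝ) ^ 3 ≤ Real.pi ^ 3 := by gcongr
  rw [div_div, div_le_div_iff₀ (by positivity) (by norm_num)]
  nlinarith

lemma numeric_trivial (d N : ℕ) (hN1 : 1 ≤ N) (hN : N < 4 * d) :
    1 ≤ 2 * Real.exp (2 * d * N * (Real.log N + 3)) *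
        Real.exp (-(2 / (9 * Real.pi ^ 3 * Real.log 2)) * N ^ 2 / 16) := by
  have hNr : (1:ℝ) ≤ N := by exact_mod_cast hN1
  have h4 : (N:ℝ) ≤ 4 * d := by exact_mod_cast hN.le
  have hl : 0 ≤ Real.log N := Real.log_nonneg hNr
  have hc := numeric_const
  set c := 2 / (9 * Real.pi ^ 3 * Real.log 2)
  rw [mul_assoc, ← Real.exp_add]
  have h0 : 0 ≤ 2 * d * N * (Real.log N + 3) + -c * N ^ 2 / 16 := by
    have a1 : c / 16 * (N:ℝ) ^ 2 ≤ 1 / 8 * (N:ℝ) ^ 2 := by gcongr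
    have a2 : (N:ℝ) ^ 2 ≤ 4 * d * N := by nlinarith
    have a3 : 0 ≤ 2 * d * N * Real.log N := by positivity
    have a4 : (0:ℝ) ≤ d * N := by positivity
    nlinarith
  have := Real.one_le_exp h0
  linarith

lemma numeric_main (d N : ℕ) (hN : 1 ≤ N) :
    ((2 * N + 1 : ℝ) ^ 2) ^ (d * N) * ((N ^ 2 / 4).factorial / ((N : ℝ) ^ 2 / 2) ^ (N ^ 2 / 4)) ≤
      2 * Real.exp (2 * d * N * (Real.log N + 3)) *
        Real.exp (-(2 / (9 * Real.pi ^ 3 * Real.log 2)) * N ^ 2 / 16) := by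
  have hNr : (1:ℝ) ≤ N := by exact_mod_cast hN
  have hc := numeric_const
  set c := 2 / (9 * Real.pi ^ 3 * Real.log 2)
  have h1 : ((2 * N + 1 : ℝ) ^ 2) ^ (d * N) ≤ Real.exp (2 * d * N * (Real.log N + 3)) := by
    have : (2 * N + 1 : ℝ) ≤ Real.exp (Real.log N + 3) := by
      rw [Real.exp_add, Real.exp_log (by positivity)]
      have := Real.add_one_le_exp (3:ℝ)
      nlinarith
    calc _ ≤ (Real.exp (Real.log N + 3) ^ 2) ^ (d * N) := by gcongr
      _ = _ := by
        rw [← pow_mul, ← Real.exp_nat_mul]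
        push_cast
        ring_nf
  set k := N ^ 2 / 4 with hk
  have hk1 : (k : ℝ) ≤ (N:ℝ) ^ 2 / 4 := by
    have := @Nat.cast_div_le ℝ _ _ _ (N ^ 2) 4
    push_cast at this
    exact this
  have hk2 : (N:ℝ) ^ 2 / 4 ≤ k + 1 := by
    have : N ^ 2 ≤ 4 * (k + 1) := by omega
    have : (N:ℝ) ^ 2 ≤ 4 * (k + 1) := by exact_mod_cast this
    linarith
  have h2 : (k.factorial : ℝ) / ((N : ℝ) ^ 2 / 2) ^ k ≤ 2 * Real.exp (-c * N ^ 2 / 16) := by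
    have a1 : (k.factorial : ℝ) ≤ (k:ℝ) ^ k := by exact_mod_cast Nat.factorial_le_pow k
    have a2 : (k.factorial : ℝ) / ((N : ℝ) ^ 2 / 2) ^ k ≤ (1 / 2) ^ k := by
      rw [div_le_iff₀ (by positivity), ← mul_pow]
      refine a1.trans ?_
      gcongr
      linarith
    have a3 : ((1:ℝ) / 2) ^ k = 2 * Real.exp (- ((k + 1) * Real.log 2)) := by
      rw [Real.exp_neg, add_mul, Real.exp_add, one_mul, Real.exp_log (by norm_num),
        Real.exp_nat_mul, Real.exp_log (by norm_num)]
      field_simp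
      simp
    rw [a3] at a2
    refine a2.trans ?_
    gcongr
    have := Real.log_two_gt_d9
    have a1 : c / 16 * (N:ℝ) ^ 2 ≤ 1 / 8 * (N:ℝ) ^ 2 := by gcongr
    nlinarith
  calc _ ≤ Real.exp (2 * d * N * (Real.log N + 3)) * (2 * Real.exp (-c * N ^ 2 / 16)) := by
        gcongr
    _ = _ := by ring

/-- **Theorem 1, geometric-entanglement form.** For the unitarily invariant
probability measure `σ` on the unit sphere of the `N`-qudit Hilbert space, the probability
that a random pure state `ψ` admits a product state `u` with `|⟨u,ψ⟩|² ≥ N²/dᴺ`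
(i.e. `E_g(ψ) ≤ N ln d − 2 ln N`) is at most
`2 · exp(2dN(ln N + 3)) · exp(−C₁N²/16)` with `C₁ = 2/(9π³ ln 2)`. -/
theorem haar_geometric_entanglement_tail (d N : ℕ) (hd : 2 ≤ d) (hN : 1 ≤ N)
    [MeasurableSpace (EuclideanSpace ℂ (Fin N → Fin d))]
    [BorelSpace (EuclideanSpace ℂ (Fin N → Fin d))]
    (σ : Measure (EuclideanSpace ℂ (Fin N → Fin d))) [IsProbabilityMeasure σ]
    (hsupp : σ (Metric.sphere (0 : EuclideanSpace ℂ (Fin N → Fin d)) 1) = 1)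
    (hinv : ∀ U : EuclideanSpace ℂ (Fin N → Fin d) ≃ₗᵢ[ℂ]
        EuclideanSpace ℂ (Fin N → Fin d), σ.map U = σ) :
    (σ {ψ | ∃ u, IsProductState d N u ∧
        (N : ℝ) ^ 2 / (d : ℝ) ^ N ≤ ‖⟪u, ψ⟫‖ ^ 2}).toReal ≤
      2 * Real.exp (2 * d * N * (Real.log N + 3)) *
        Real.exp (-(2 / (9 * Real.pi ^ 3 * Real.log 2)) * N ^ 2 / 16) := by
  classical
  by_cases hcase : N < 4 * d
  · refine le_trans ?_ (numeric_trivial d N hN hcase)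
    have h := prob_le_one (μ := σ) (s := {ψ | ∃ u, IsProductState d N u ∧
        (N : ℝ) ^ 2 / (d : ℝ) ^ N ≤ ‖⟪u, ψ⟫‖ ^ 2})
    exact ENNReal.toReal_le_of_le_ofReal zero_le_one (by simpa using h)
  push Not at hcase
  rename_i m0 b0 p0
  obtain rfl : m0 = WithLp.measurableSpace 2 ((Fin N → Fin d) → ℂ) := by
    rw [b0.measurable_eq]
    exact (BorelSpace.measurable_eq
      (self := PiLp.borelSpace 2 (X := fun _ : Fin N → Fin d => ℂ))).symm
  have hd0 : 0 < d := by omega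
  have hne : Nonempty (Fin N → Fin d) := ⟨fun _ => ⟨0, hd0⟩⟩
  have hdr : (0:ℝ) < d := by exact_mod_cast hd0
  have hNr : (0:ℝ) < N := by exact_mod_cast hN
  refine le_trans ?_ (numeric_main d N hN)
  apply ENNReal.toReal_le_of_le_ofReal (by positivity)
  have hsub : {ψ : EuclideanSpace ℂ (Fin N → Fin d) | ∃ u, IsProductState d N u ∧
        (N : ℝ) ^ 2 / (d : ℝ) ^ N ≤ ‖⟪u, ψ⟫‖ ^ 2} ⊆
      ⋃ G : Fin N → Fin d → Fin (2 * N + 1) × Fin (2 * N + 1),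
        {ψ | 1 / 2 * ((N : ℝ) ^ 2 / (d : ℝ) ^ N) ≤
          ‖⟪prodVec (fun i => (netVec d N hd0 (G i)).ofLp), ψ⟫‖ ^ 2} := by
    rintro ψ ⟨u, ⟨f, hf, hu⟩, hle⟩
    have : u = prodVec f := by
      ext x
      exact hu x
    subst this
    obtain ⟨G, hG⟩ := net_cover d N hd0 hcase f hf ψ
    refine Set.mem_iUnion.2 ⟨G, le_trans ?_ hG⟩
    gcongr
  refine (measure_mono hsub).trans ((measure_iUnion_fintype_le _ _).trans ?_)
  have hb : ∀ G : Fin N → Fin d → Fin (2 * N + 1) × Fin (2 * N + 1),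
      σ {ψ | 1 / 2 * ((N : ℝ) ^ 2 / (d : ℝ) ^ N) ≤
          ‖⟪prodVec (fun i => (netVec d N hd0 (G i)).ofLp), ψ⟫‖ ^ 2} ≤
      ENNReal.ofReal ((N ^ 2 / 4).factorial / ((N : ℝ) ^ 2 / 2) ^ (N ^ 2 / 4)) := by
    intro G
    refine (sphere_tail_s5 σ hsupp hinv _ (prodVec_norm _ ?_) (N ^ 2 / 4) _ (by positivity)).trans
      (le_of_eq ?_)
    · intro i
      rw [← EuclideanSpace.norm_sq_eq, netVec_norm, one_pow]
    · congr 3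
      simp only [Fintype.card_fun, Fintype.card_fin]
      push_cast
      field_simp
  refine (Finset.sum_le_sum fun G _ => hb G).trans (le_of_eq ?_)
  rw [Finset.sum_const, nsmul_eq_mul, ENNReal.ofReal_mul (by positivity)]
  congr 1
  rw [← ENNReal.ofReal_natCast]
  congr 1
  simp only [Finset.card_univ, Fintype.card_fun, Fintype.card_fin, Fintype.card_prod]
  push_cast
  rw [← pow_mul, ← sq]
end

section
/- Let D ≥ 1 and t ≥ 1 be integers, let σ be the unitarily invariant (uniform) probability measure on the unit sphere of ℂ^D, and let v be a fixed unit vector in ℂ^D. Then the 2t-th moment of the overlap satisfies ∫ |⟨v, ψ⟩|^(2t) dσ(ψ) = t! · (D−1)! / (t+D−1)!. -/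
open MeasureTheory
open scoped ComplexInnerProductSpace

namespace HaarMoment

open Complex ComplexConjugate

lemma exists_unitary {D : ℕ} (i j : Fin D) (hij : i ≠ j) (u w : EuclideanSpace ℂ (Fin D))
    (hu : ‖u‖ = 1) (hw : ‖w‖ = 1) (huw : ⟪u, w⟫ = 0) :
    ∃ U : EuclideanSpace ℂ (Fin D) ≃ₗᵢ[ℂ] EuclideanSpace ℂ (Fin D),
      ∀ ψ, (U ψ) i = ⟪u, ψ⟫ ∧ (U ψ) j = ⟪w, ψ⟫ := by
  have hwu : ⟪w, u⟫ = 0 := inner_eq_zero_symm.mp huw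
  obtain ⟨b, hb⟩ := Orthonormal.exists_orthonormalBasis_extension_of_card_eq (𝕜 := ℂ)
    (E := EuclideanSpace ℂ (Fin D)) (ι := Fin D) (by simp)
    (v := fun k => if k = i then u else w) (s := {i, j}) (by
      constructor
      · rintro ⟨k, hk⟩
        by_cases h : k = i <;> simp [h, hu, hw]
      · rintro ⟨k, hk⟩ ⟨l, hl⟩ hkl
        have hkl' : k ≠ l := fun h => hkl (Subtype.ext h)
        rcases hk with rfl | hk <;> rcases hl with rfl | hl
        · exact absurd rfl hkl'
        · simp [hkl'.symm, huw]
        · simp [hkl', hwu]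
        · exact absurd (hk.trans hl.symm) hkl')
  refine ⟨b.repr, fun ψ => ?_⟩
  have h1 := hb i (by simp)
  have h2 := hb j (by simp)
  simp only [if_true, if_neg hij.symm] at h1 h2
  exact ⟨by rw [b.repr_apply_apply, h1], by rw [b.repr_apply_apply, h2]⟩

lemma exists_unitary_one {D : ℕ} (i : Fin D) (u : EuclideanSpace ℂ (Fin D)) (hu : ‖u‖ = 1) :
    ∃ U : EuclideanSpace ℂ (Fin D) ≃ₗᵢ[ℂ] EuclideanSpace ℂ (Fin D),
      ∀ ψ, (U ψ) i = ⟪u, ψ⟫ := by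
  obtain ⟨b, hb⟩ := Orthonormal.exists_orthonormalBasis_extension_of_card_eq (𝕜 := ℂ)
    (E := EuclideanSpace ℂ (Fin D)) (ι := Fin D) (by simp)
    (v := fun k => u) (s := {i}) (by
      constructor
      · rintro ⟨k, hk⟩
        simp [hu]
      · rintro ⟨k, hk⟩ ⟨l, hl⟩ hkl
        exact absurd (Subtype.ext (hk.trans hl.symm)) hkl)
  refine ⟨b.repr, fun ψ => ?_⟩
  rw [b.repr_apply_apply, hb i (by simp)]

/-- SU(2) rotation in two coordinates. -/
lemma exists_rot {D : ℕ} (i j : Fin D) (hij : i ≠ j) (a b : ℂ)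
    (hab : a * conj a + b * conj b = 1) :
    ∃ U : EuclideanSpace ℂ (Fin D) ≃ₗᵢ[ℂ] EuclideanSpace ℂ (Fin D),
      ∀ ψ, (U ψ) i = a * ψ i + b * ψ j ∧ (U ψ) j = conj a * ψ j - conj b * ψ i := by
  set e : Fin D → EuclideanSpace ℂ (Fin D) := fun k => EuclideanSpace.single k 1
  have hn : ∀ z : EuclideanSpace ℂ (Fin D), ⟪z, z⟫ = 1 → ‖z‖ = 1 := by
    intro z hz
    have : ‖z‖ ^ 2 = 1 := by
      rw [← inner_self_eq_norm_sq (𝕜 := ℂ) z, hz]; simp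
    nlinarith [norm_nonneg z]
  have n1 : ⟪conj a • e i + conj b • e j, conj a • e i + conj b • e j⟫ = 1 := by
    simp only [e, inner_add_left, inner_add_right, inner_smul_left, inner_smul_right,
      EuclideanSpace.inner_single_left]
    simp [hij, hij.symm]
    linear_combination hab
  have n2 : ⟪a • e j - b • e i, a • e j - b • e i⟫ = 1 := by
    simp only [e, inner_sub_left, inner_sub_right, inner_smul_left, inner_smul_right,
      EuclideanSpace.inner_single_left]
    simp [hij, hij.symm]
    linear_combination hab
  have n3 : ⟪conj a • e i + conj b • e j, a • e j - b • e i⟫ = 0 := by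
    simp only [e, inner_add_left, inner_sub_right, inner_smul_left, inner_smul_right,
      EuclideanSpace.inner_single_left]
    simp [hij, hij.symm]
    ring
  obtain ⟨U, hU⟩ := exists_unitary i j hij _ _ (hn _ n1) (hn _ n2) n3
  refine ⟨U, fun ψ => ⟨(hU ψ).1.trans ?_, (hU ψ).2.trans ?_⟩⟩
  · simp only [e, inner_add_left, inner_smul_left, EuclideanSpace.inner_single_left]
    simp
  · simp only [e, inner_sub_left, inner_smul_left, EuclideanSpace.inner_single_left]
    simp

variable {D : ℕ} [MeasurableSpace (EuclideanSpace ℂ (Fin D))]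
    [BorelSpace (EuclideanSpace ℂ (Fin D))]
    {σ : Measure (EuclideanSpace ℂ (Fin D))} [IsProbabilityMeasure σ]

lemma ae_sphere (hsupp : σ (Metric.sphere (0 : EuclideanSpace ℂ (Fin D)) 1) = 1) :
    ∀ᵐ ψ ∂σ, ψ ∈ Metric.sphere (0 : EuclideanSpace ℂ (Fin D)) 1 := by
  have := (prob_compl_eq_zero_iff (μ := σ)
    (Metric.isClosed_sphere (x := (0 : EuclideanSpace ℂ (Fin D))) (ε := 1)).measurableSet).2 hsupp
  exact this

lemma integrable_cont {E : Type*} [NormedAddCommGroup E] [SecondCountableTopology E]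
    (hsupp : σ (Metric.sphere (0 : EuclideanSpace ℂ (Fin D)) 1) = 1)
    {f : EuclideanSpace ℂ (Fin D) → E} (hf : Continuous f) : Integrable f σ := by
  have h := (hf.continuousOn (s := Metric.sphere 0 1)).integrableOn_compact
    (μ := σ) (isCompact_sphere (0 : EuclideanSpace ℂ (Fin D)) 1)
  rwa [IntegrableOn, Measure.restrict_eq_self_of_ae_mem (ae_sphere hsupp)] at h

lemma integral_inv {E : Type*} [NormedAddCommGroup E] [NormedSpace ℝ E]
    [SecondCountableTopology E]
    (hinv : ∀ U : EuclideanSpace ℂ (Fin D) ≃ₗᵢ[ℂ] EuclideanSpace ℂ (Fin D), σ.map U = σ)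
    (U : EuclideanSpace ℂ (Fin D) ≃ₗᵢ[ℂ] EuclideanSpace ℂ (Fin D))
    {f : EuclideanSpace ℂ (Fin D) → E} (hf : Continuous f) :
    ∫ ψ, f (U ψ) ∂σ = ∫ ψ, f ψ ∂σ := by
  conv_rhs => rw [← hinv U]
  rw [integral_map U.continuous.measurable.aemeasurable hf.aestronglyMeasurable]

lemma middle_zero
    (hinv : ∀ U : EuclideanSpace ℂ (Fin D) ≃ₗᵢ[ℂ] EuclideanSpace ℂ (Fin D), σ.map U = σ)
    (i j : Fin D) (hij : i ≠ j) (n : ℕ) :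
    ∫ ψ, (ψ i) ^ (n + 2) * (conj (ψ i)) ^ n * conj (ψ j) ^ 2 ∂σ = 0 := by
  obtain ⟨a, ha⟩ : ∃ a : ℂ, a = (3 + 4 * I) / 5 := ⟨_, rfl⟩
  have hca : conj a = (3 - 4 * I) / 5 := by
    simp [ha, map_ofNat, sub_eq_add_neg]
  have haa : a * conj a = 1 := by
    rw [hca, ha]; linear_combination (-16/25) * I_sq
  obtain ⟨U, hU⟩ := exists_rot i j hij a 0 (by simp [haa])
  have h := integral_inv hinv U
    (f := fun ψ => (ψ i) ^ (n + 2) * (conj (ψ i)) ^ n * conj (ψ j) ^ 2) (by fun_prop)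
  have h2 : ∀ ψ : EuclideanSpace ℂ (Fin D),
      ((U ψ) i) ^ (n + 2) * (conj ((U ψ) i)) ^ n * conj ((U ψ) j) ^ 2
      = a ^ 4 * ((ψ i) ^ (n + 2) * (conj (ψ i)) ^ n * conj (ψ j) ^ 2) := by
    intro ψ
    rw [(hU ψ).1, (hU ψ).2]
    simp only [map_mul, map_sub, map_zero, zero_mul, add_zero, sub_zero, conj_conj]
    have : a ^ n * (conj a) ^ n = 1 := by rw [← mul_pow, haa, one_pow]
    linear_combination a ^ 4 * ((ψ i) ^ (n + 2) * (conj (ψ i)) ^ n * conj (ψ j) ^ 2) * this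
  simp only [h2] at h
  rw [integral_const_mul] at h
  have h4 : a ^ 4 ≠ 1 := by
    intro h
    have h5 : a ^ 4 = (-527 - 336 * I) / 625 := by
      rw [ha]; ring_nf
      have e3 : I ^ 3 = -I := by rw [pow_succ, I_sq]; ring
      have e4 : I ^ 4 = 1 := I_pow_four
      rw [e3, e4, I_sq]; ring
    rw [h5] at h
    have := congrArg Complex.re h
    norm_num at this
  have : (a ^ 4 - 1) * ∫ ψ, (ψ i) ^ (n + 2) * (conj (ψ i)) ^ n * conj (ψ j) ^ 2 ∂σ = 0 := by
    linear_combination h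
  exact (mul_eq_zero.mp this).resolve_left (sub_ne_zero.mpr h4)

/-- integrand after rotation -/
noncomputable def G (n : ℕ) (x y : ℂ) (s : ℝ) : ℂ :=
  (Real.cos s * x + Real.sin s * y) ^ (n + 1) *
    (Real.cos s * conj x + Real.sin s * conj y) ^ n *
    (Real.cos s * conj y - Real.sin s * conj x)

noncomputable def dG (n : ℕ) (x y : ℂ) (s : ℝ) : ℂ :=
  (((n + 1 : ℕ) * (Real.cos s * x + Real.sin s * y) ^ n * (Real.cos s * y - Real.sin s * x)) *
    (Real.cos s * conj x + Real.sin s * conj y) ^ n +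
  (Real.cos s * x + Real.sin s * y) ^ (n + 1) *
    (n * (Real.cos s * conj x + Real.sin s * conj y) ^ (n - 1) *
      (Real.cos s * conj y - Real.sin s * conj x))) *
    (Real.cos s * conj y - Real.sin s * conj x) +
  (Real.cos s * x + Real.sin s * y) ^ (n + 1) *
    (Real.cos s * conj x + Real.sin s * conj y) ^ n *
    (-(Real.cos s * conj x + Real.sin s * conj y))

lemma hasDerivAt_G (n : ℕ) (x y : ℂ) (s : ℝ) : HasDerivAt (G n x y) (dG n x y s) s := by
  have hc : HasDerivAt (fun s : ℝ => ((Real.cos s : ℝ) : ℂ)) ((-Real.sin s : ℝ) : ℂ) s :=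
    (Real.hasDerivAt_cos s).ofReal_comp
  have hs : HasDerivAt (fun s : ℝ => ((Real.sin s : ℝ) : ℂ)) ((Real.cos s : ℝ) : ℂ) s :=
    (Real.hasDerivAt_sin s).ofReal_comp
  have hX := (hc.mul_const x).add (hs.mul_const y)
  have hX' := (hc.mul_const (conj x)).add (hs.mul_const (conj y))
  have hY' := (hc.mul_const (conj y)).sub (hs.mul_const (conj x))
  have h := ((hX.pow (n + 1)).mul (hX'.pow n)).mul hY'
  refine HasDerivAt.congr_deriv (f := G n x y) h ?_
  unfold dG
  simp only [Pi.add_apply, Pi.sub_apply, Pi.mul_apply, Pi.pow_apply, Nat.add_sub_cancel]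
  push_cast
  ring

lemma norm_comb_le (x y : ℂ) (hx : ‖x‖ ≤ 1) (hy : ‖y‖ ≤ 1) (s : ℝ) :
    ‖(Real.cos s : ℂ) * x + (Real.sin s : ℂ) * y‖ ≤ 2 := by
  have h1 : ‖(Real.cos s : ℂ) * x‖ ≤ 1 := by
    rw [norm_mul, norm_real]
    exact mul_le_one₀ (Real.abs_cos_le_one s) (norm_nonneg _) hx
  have h2 : ‖(Real.sin s : ℂ) * y‖ ≤ 1 := by
    rw [norm_mul, norm_real]
    exact mul_le_one₀ (Real.abs_sin_le_one s) (norm_nonneg _) hy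
  linarith [norm_add_le ((Real.cos s : ℂ) * x) ((Real.sin s : ℂ) * y)]

lemma norm_dG_le (n : ℕ) (x y : ℂ) (hx : ‖x‖ ≤ 1) (hy : ‖y‖ ≤ 1) (s : ℝ) :
    ‖dG n x y s‖ ≤ (((n + 1 : ℕ) * 2 ^ n * 2) * 2 ^ n + 2 ^ (n + 1) * (n * 2 ^ (n - 1) * 2)) * 2
      + 2 ^ (n + 1) * 2 ^ n * 2 := by
  have hcx : ‖conj x‖ ≤ 1 := by simpa using hx
  have hcy : ‖conj y‖ ≤ 1 := by simpa using hy
  have a1 := norm_comb_le x y hx hy s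
  have a2 := norm_comb_le _ _ hcx hcy s
  have a3 : ‖(Real.cos s : ℂ) * y - (Real.sin s : ℂ) * x‖ ≤ 2 := by
    simpa [sub_eq_add_neg] using norm_comb_le y (-x) hy (by simpa using hx) s
  have a4 : ‖(Real.cos s : ℂ) * conj y - (Real.sin s : ℂ) * conj x‖ ≤ 2 := by
    simpa [sub_eq_add_neg] using norm_comb_le (conj y) (-conj x) hcy (by simpa using hx) s
  unfold dG
  refine (norm_add_le _ _).trans (add_le_add ?_ ?_)
  · rw [norm_mul]
    refine mul_le_mul ((norm_add_le _ _).trans (add_le_add ?_ ?_)) a4 (norm_nonneg _)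
      (by positivity)
    · simp only [norm_mul, norm_pow, norm_natCast]
      gcongr
    · simp only [norm_mul, norm_pow, norm_natCast]
      gcongr
  · simp only [norm_mul, norm_pow, norm_neg]
    gcongr

lemma key
    (hsupp : σ (Metric.sphere (0 : EuclideanSpace ℂ (Fin D)) 1) = 1)
    (hinv : ∀ U : EuclideanSpace ℂ (Fin D) ≃ₗᵢ[ℂ] EuclideanSpace ℂ (Fin D), σ.map U = σ)
    (i j : Fin D) (hij : i ≠ j) (n : ℕ) :
    (n + 1 : ℂ) * ∫ ψ, (ψ i * conj (ψ i)) ^ n * (ψ j * conj (ψ j)) ∂σ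
      = ∫ ψ, (ψ i * conj (ψ i)) ^ (n + 1) ∂σ := by
  have hconst : ∀ s : ℝ, ∫ ψ, G n (ψ i) (ψ j) s ∂σ
      = ∫ ψ, (ψ i) ^ (n + 1) * conj (ψ i) ^ n * conj (ψ j) ∂σ := by
    intro s
    obtain ⟨U, hU⟩ := exists_rot i j hij (Real.cos s) (Real.sin s) (by
      rw [conj_ofReal, conj_ofReal]
      have := Real.cos_sq_add_sin_sq s
      norm_cast
      linarith)
    rw [← integral_inv hinv U
      (f := fun ψ => (ψ i) ^ (n + 1) * conj (ψ i) ^ n * conj (ψ j)) (by fun_prop)]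
    refine integral_congr_ae (Filter.Eventually.of_forall fun ψ => ?_)
    simp only [(hU ψ).1, (hU ψ).2, G, map_add, map_sub, map_mul, conj_ofReal]
  have hcontG : ∀ s, Continuous (fun ψ : EuclideanSpace ℂ (Fin D) => G n (ψ i) (ψ j) s) := by
    intro s; unfold G; fun_prop
  have hcontdG : ∀ s, Continuous (fun ψ : EuclideanSpace ℂ (Fin D) => dG n (ψ i) (ψ j) s) := by
    intro s; unfold dG; fun_prop
  have hd := (hasDerivAt_integral_of_dominated_loc_of_deriv_le (μ := σ) (x₀ := (0 : ℝ))
    (s := Set.univ) (F := fun s ψ => G n (ψ i) (ψ j) s) (F' := fun s ψ => dG n (ψ i) (ψ j) s)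
    (bound := fun _ => (((n + 1 : ℕ) * 2 ^ n * 2) * 2 ^ n + 2 ^ (n + 1) * (n * 2 ^ (n - 1) * 2)) * 2
      + 2 ^ (n + 1) * 2 ^ n * 2)
    Filter.univ_mem
    (Filter.Eventually.of_forall fun s => (hcontG s).aestronglyMeasurable)
    (integrable_cont hsupp (hcontG 0)) (hcontdG 0).aestronglyMeasurable
    (by
      filter_upwards [ae_sphere hsupp] with ψ hψ s _
      have hψ' : ‖ψ‖ = 1 := by simpa using hψ
      exact norm_dG_le n _ _ (hψ' ▸ PiLp.norm_apply_le ψ i) (hψ' ▸ PiLp.norm_apply_le ψ j) s)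
    (integrable_const _)
    (Filter.Eventually.of_forall fun ψ s _ => hasDerivAt_G n _ _ s)).2
  simp only [hconst] at hd
  have h0 := hd.unique (hasDerivAt_const _ _)
  have hmid : ∫ ψ, (n : ℂ) * ((ψ i) ^ (n + 1) * conj (ψ i) ^ (n - 1) * conj (ψ j) ^ 2) ∂σ = 0 := by
    rw [integral_const_mul]
    rcases n with _ | n
    · simp
    · rw [Nat.add_sub_cancel, middle_zero hinv i j hij n, mul_zero]
  have hdG0 : ∀ ψ : EuclideanSpace ℂ (Fin D), dG n (ψ i) (ψ j) 0 =
      ((n + 1 : ℂ) * ((ψ i * conj (ψ i)) ^ n * (ψ j * conj (ψ j))) +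
       (n : ℂ) * ((ψ i) ^ (n + 1) * conj (ψ i) ^ (n - 1) * conj (ψ j) ^ 2)) -
       (ψ i * conj (ψ i)) ^ (n + 1) := by
    intro ψ
    simp only [dG, Real.cos_zero, Real.sin_zero]
    push_cast
    ring
  simp only [hdG0] at h0
  rw [integral_sub, integral_add, hmid, integral_const_mul] at h0
  · linear_combination h0
  all_goals exact integrable_cont hsupp (by fun_prop)

lemma recursion
    (hsupp : σ (Metric.sphere (0 : EuclideanSpace ℂ (Fin D)) 1) = 1)
    (hinv : ∀ U : EuclideanSpace ℂ (Fin D) ≃ₗᵢ[ℂ] EuclideanSpace ℂ (Fin D), σ.map U = σ)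
    (i : Fin D) (n : ℕ) :
    (n + 1 : ℂ) * ∫ ψ, (ψ i * conj (ψ i)) ^ n ∂σ
      = (n + D : ℂ) * ∫ ψ, (ψ i * conj (ψ i)) ^ (n + 1) ∂σ := by
  have h1 : ∫ ψ, (ψ i * conj (ψ i)) ^ n ∂σ =
      ∑ j, ∫ ψ, (ψ i * conj (ψ i)) ^ n * (ψ j * conj (ψ j)) ∂σ := by
    rw [← integral_finsetSum _ (fun j _ => integrable_cont hsupp (by fun_prop))]
    refine integral_congr_ae ?_
    filter_upwards [ae_sphere hsupp] with ψ hψ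
    have hψ' : ‖ψ‖ = 1 := by simpa using hψ
    have : ∑ j, ψ j * conj (ψ j) = 1 := by
      have h := EuclideanSpace.norm_sq_eq ψ
      rw [hψ'] at h
      simp only [mul_conj, normSq_eq_norm_sq]
      exact_mod_cast h.symm.trans (by norm_num)
    rw [← Finset.mul_sum, this, mul_one]
  rw [h1, ← Finset.add_sum_erase _ _ (Finset.mem_univ i), mul_add, Finset.mul_sum,
    Finset.sum_congr rfl (fun j hj => key hsupp hinv i j (Finset.ne_of_mem_erase hj).symm n)]
  rw [Finset.sum_const, Finset.card_erase_of_mem (Finset.mem_univ i), Finset.card_univ,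
    Fintype.card_fin, nsmul_eq_mul, Nat.cast_sub (Nat.one_le_of_lt i.2)]
  simp only [← pow_succ]
  push_cast
  ring

lemma moment
    (hsupp : σ (Metric.sphere (0 : EuclideanSpace ℂ (Fin D)) 1) = 1)
    (hinv : ∀ U : EuclideanSpace ℂ (Fin D) ≃ₗᵢ[ℂ] EuclideanSpace ℂ (Fin D), σ.map U = σ)
    (i : Fin D) (n : ℕ) :
    ((n + D - 1).factorial : ℂ) * ∫ ψ, (ψ i * conj (ψ i)) ^ n ∂σ
      = n.factorial * (D - 1).factorial := by
  induction n with
  | zero => simp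
  | succ n ih =>
    have hD : 1 ≤ D := Nat.one_le_of_lt i.2
    have hr := recursion hsupp hinv i n
    have e : n + 1 + D - 1 = (n + D - 1) + 1 := by omega
    have e2 : ((n + D - 1 : ℕ) : ℂ) + 1 = n + D := by
      have : n + D - 1 + 1 = n + D := by omega
      exact_mod_cast this
    rw [e, Nat.factorial_succ, Nat.factorial_succ]
    push_cast
    rw [e2]
    linear_combination (n + 1 : ℂ) * ih - ((n + D - 1).factorial : ℂ) * hr

end HaarMoment

/-- For the unitarily invariant probability measure `σ` on the unit sphere
of `ℂ^D` and a fixed unit vector `v`, the `2t`-th overlap moment is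
`∫ |⟨v,ψ⟩|^(2t) dσ = t!(D−1)!/(t+D−1)!`. -/
theorem haar_overlap_moment (D t : ℕ) (hD : 1 ≤ D) (ht : 1 ≤ t)
    [MeasurableSpace (EuclideanSpace ℂ (Fin D))]
    [BorelSpace (EuclideanSpace ℂ (Fin D))]
    (σ : Measure (EuclideanSpace ℂ (Fin D))) [IsProbabilityMeasure σ]
    (hsupp : σ (Metric.sphere (0 : EuclideanSpace ℂ (Fin D)) 1) = 1)
    (hinv : ∀ U : EuclideanSpace ℂ (Fin D) ≃ₗᵢ[ℂ] EuclideanSpace ℂ (Fin D),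
      σ.map U = σ)
    (v : EuclideanSpace ℂ (Fin D)) (hv : ‖v‖ = 1) :
    ∫ ψ, ‖⟪v, ψ⟫‖ ^ (2 * t) ∂σ =
      ((t.factorial : ℝ) * (D - 1).factorial) / ((t + D - 1).factorial : ℝ) := by
  obtain ⟨U, hU⟩ := HaarMoment.exists_unitary_one (⟨0, hD⟩ : Fin D) v hv
  have h1 := HaarMoment.integral_inv hinv U
    (f := fun ψ => ‖ψ (⟨0, hD⟩ : Fin D)‖ ^ (2 * t)) (by fun_prop)
  simp only [hU] at h1
  rw [h1, eq_div_iff (by positivity)]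
  have h2 := HaarMoment.moment hsupp hinv (⟨0, hD⟩ : Fin D) t
  have h3 : ∀ ψ : EuclideanSpace ℂ (Fin D),
      (ψ (⟨0, hD⟩ : Fin D) * (starRingEnd ℂ) (ψ (⟨0, hD⟩ : Fin D))) ^ t =
        ((‖ψ (⟨0, hD⟩ : Fin D)‖ ^ (2 * t) : ℝ) : ℂ) := by
    intro ψ
    rw [Complex.mul_conj, Complex.normSq_eq_norm_sq, pow_mul]
    push_cast
    rfl
  simp only [h3] at h2
  rw [integral_complex_ofReal] at h2
  rw [mul_comm]
  exact_mod_cast h2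
end
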